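/- Let a and b be positive real constants satisfying the nine inequalities: 2a + b ≥ 1, 3a + 4b ≥ 2, 9a + 11b ≥ 6, a + 5b ≥ 1, 4a + 9b ≥ 3, 10a + 16b ≥ 7, 13a + 20b ≥ 8, 5a + 14b ≥ 4, and a + (3/2)b ≥ 2/3. Then every finite simple graph G with no triangle adjacent to a 4-cycle satisfies α(G) ≥ |V(G)| − (a·|V(G)| + b·|E(G)| + b·λ(G)). -/

import Mathlib

namespace Paper

/-- `s` is an independent set in the simple graph `G`. -/
def IsIndepSet {V : Type} (G : SimpleGraph V) (s : Finset V) : Prop :=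
  ∀ v ∈ s, ∀ w ∈ s, ¬ G.Adj v w

/-- The independence number `α(G)`: the size of a largest independent set. -/
noncomputable def indepNum {V : Type} (G : SimpleGraph V) : ℕ :=
  sSup {n | ∃ s : Finset V, IsIndepSet G s ∧ s.card = n}

/-- The number of edges `|E(G)|`. -/
noncomputable def numEdges {V : Type} (G : SimpleGraph V) : ℕ :=
  Nat.card G.edgeSet

/-- The degree of a vertex. -/
noncomputable def deg {V : Type} (G : SimpleGraph V) (v : V) : ℕ :=
  Nat.card (G.neighborSet v)

/-- `G` contains a triangle sharing a common edge with a 4-cycle: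
the triangle `u v w` and the 4-cycle `u v x y` share the edge `u v`. -/
def HasTriangleAdjC4 {V : Type} (G : SimpleGraph V) : Prop :=
  ∃ u v w x y : V, G.Adj u v ∧ G.Adj v w ∧ G.Adj w u ∧
    G.Adj v x ∧ G.Adj x y ∧ G.Adj y u ∧ u ≠ x ∧ v ≠ y

/-- `G` contains two triangles sharing a common edge:
the triangles `u v w` and `u v x` share the edge `u v`. -/
def HasAdjTriangles {V : Type} (G : SimpleGraph V) : Prop :=
  ∃ u v w x : V, G.Adj u v ∧ G.Adj v w ∧ G.Adj w u ∧
    G.Adj v x ∧ G.Adj x u ∧ w ≠ x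

/-- `G` contains a triangle sharing a common edge with a 5-cycle:
the triangle `u v w` and the 5-cycle `u v x y z` share the edge `u v`. -/
def HasTriangleAdjC5 {V : Type} (G : SimpleGraph V) : Prop :=
  ∃ u v w x y z : V, G.Adj u v ∧ G.Adj v w ∧ G.Adj w u ∧
    G.Adj v x ∧ G.Adj x y ∧ G.Adj y z ∧ G.Adj z u ∧
    u ≠ x ∧ u ≠ y ∧ v ≠ y ∧ v ≠ z ∧ x ≠ z

/-- The 2-chain of triangles: two disjoint triangles `{0,1,2}` and `{3,4,5}`
joined by the single edge `{2,3}` (6 vertices, 7 edges). -/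
def chainGraph : SimpleGraph (Fin 6) :=
  SimpleGraph.fromRel (fun i j =>
    (i.val, j.val) ∈ [(0,1), (0,2), (1,2), (3,4), (3,5), (4,5), (2,3)])

/-- A connected component is difficult if it is a triangle or a 2-chain of triangles. -/
def IsDifficult {V : Type} (G : SimpleGraph V) (c : G.ConnectedComponent) : Prop :=
  Nonempty (SimpleGraph.induce c.supp G ≃g (⊤ : SimpleGraph (Fin 3))) ∨
  Nonempty (SimpleGraph.induce c.supp G ≃g chainGraph)

/-- `λ(G)`: the number of difficult components of `G`. -/
noncomputable def lambda {V : Type} (G : SimpleGraph V) : ℕ :=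
  Nat.card {c : G.ConnectedComponent // IsDifficult G c}

/-- `Φ(S)`: the number of edges of `G` with exactly one endpoint in `S`. -/
noncomputable def phi {V : Type} (G : SimpleGraph V) (S : Set V) : ℕ :=
  Nat.card {e : Sym2 V | e ∈ G.edgeSet ∧ ∃ x ∈ S, ∃ y, y ∉ S ∧ e = s(x, y)}

section Counting

open scoped Classical

variable {V : Type} (G : SimpleGraph V)

/-- The neighbours of `v` lying in `W`. -/
noncomputable def nbrs (W : Finset V) (v : V) : Finset V := W.filter (G.Adj v)

/-- The number of edges of `G` with both endpoints in `W`. -/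
noncomputable def edgesIn (W : Finset V) : ℕ := (W.sym2.filter (· ∈ G.edgeSet)).card

/-- The number of edges of `G` between `R` and `S`, when these are disjoint. -/
noncomputable def edgesBetween (R S : Finset V) : ℕ := ∑ r ∈ R, (nbrs G S r).card

variable {G}

lemma mem_nbrs {W : Finset V} {v w : V} : w ∈ nbrs G W v ↔ w ∈ W ∧ G.Adj v w := by
  simp [nbrs]

lemma nbrs_union {R S : Finset V} (v : V) : nbrs G (R ∪ S) v = nbrs G R v ∪ nbrs G S v := by
  simp [nbrs, Finset.filter_union]

lemma card_nbrs_union {R S : Finset V} (h : Disjoint R S) (v : V) :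
    (nbrs G (R ∪ S) v).card = (nbrs G R v).card + (nbrs G S v).card := by
  rw [nbrs_union, Finset.card_union_of_disjoint]
  exact Finset.disjoint_filter_filter h

lemma card_nbrs_sdiff {R W : Finset V} (h : R ⊆ W) (v : V) :
    (nbrs G W v).card = (nbrs G R v).card + (nbrs G (W \ R) v).card := by
  rw [← card_nbrs_union Finset.disjoint_sdiff, Finset.union_sdiff_of_subset h]

lemma edgesBetween_comm (R S : Finset V) : edgesBetween G R S = edgesBetween G S R := by
  simp only [edgesBetween, nbrs, Finset.card_filter]
  rw [Finset.sum_comm]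
  simp only [G.adj_comm]

lemma edgesIn_insert {W : Finset V} {v : V} (hv : v ∉ W) :
    edgesIn G (insert v W) = edgesIn G W + (nbrs G W v).card := by
  have h : ((insert v W).sym2.filter (· ∈ G.edgeSet)) =
      (W.sym2.filter (· ∈ G.edgeSet)) ∪ (nbrs G W v).image (fun w => s(v, w)) := by
    ext e
    induction e using Sym2.ind with
    | _ x y =>
      simp only [Finset.mem_filter, Finset.mk_mem_sym2_iff, Finset.mem_insert,
        SimpleGraph.mem_edgeSet, Finset.mem_union, Finset.mem_image, mem_nbrs, Sym2.eq_iff]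
      have := G.adj_comm x y
      have := G.loopless.irrefl v
      grind
  rw [edgesIn, h, Finset.card_union_of_disjoint, Finset.card_image_of_injOn]
  · rfl
  · intro x _ y _ hxy
    exact Sym2.congr_right.1 hxy
  · rw [Finset.disjoint_left]
    intro e he he'
    obtain ⟨w, -, rfl⟩ := Finset.mem_image.1 he'
    simp [hv] at he

@[simp] lemma edgesIn_empty : edgesIn G ∅ = 0 := by simp [edgesIn]

lemma edgesIn_union {R S : Finset V} (h : Disjoint R S) :
    edgesIn G (R ∪ S) = edgesIn G R + edgesIn G S + edgesBetween G R S := by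
  induction R using Finset.induction_on with
  | empty => simp [edgesBetween]
  | insert v R hv ih =>
    rw [Finset.disjoint_insert_left] at h
    rw [Finset.insert_union, edgesIn_insert (by simp [hv, h.1]), ih h.2, edgesIn_insert hv,
      card_nbrs_union h.2, edgesBetween, edgesBetween, Finset.sum_insert hv]
    ring

lemma edgesIn_eq_add_sdiff {R W : Finset V} (h : R ⊆ W) :
    edgesIn G W = edgesIn G R + edgesIn G (W \ R) + edgesBetween G R (W \ R) := by
  rw [← edgesIn_union Finset.disjoint_sdiff, Finset.union_sdiff_of_subset h]

lemma sum_card_nbrs_self (R : Finset V) : ∑ r ∈ R, (nbrs G R r).card = 2 * edgesIn G R := by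
  induction R using Finset.induction_on with
  | empty => simp
  | insert v R hv ih =>
    have key : ∀ r, (nbrs G (insert v R) r).card =
        (nbrs G {v} r).card + (nbrs G R r).card := fun r => by
      rw [Finset.insert_eq, card_nbrs_union (by simpa using hv)]
    have h2 := edgesBetween_comm (G := G) R {v}
    have h3 : nbrs G {v} v = ∅ := by simp [nbrs, Finset.filter_singleton]
    simp only [edgesBetween, Finset.sum_singleton] at h2
    rw [Finset.sum_insert hv, edgesIn_insert hv, mul_add, ← ih, key, h3]
    simp only [key, Finset.sum_add_distrib, h2, Finset.card_empty]
    ring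

lemma sum_card_nbrs {R W : Finset V} (h : R ⊆ W) :
    ∑ r ∈ R, (nbrs G W r).card = 2 * edgesIn G R + edgesBetween G R (W \ R) := by
  rw [← sum_card_nbrs_self, edgesBetween, ← Finset.sum_add_distrib]
  exact Finset.sum_congr rfl fun r _ => card_nbrs_sdiff h r

lemma edgesIn_insert_ge {R S : Finset V} {v : V} (hv : v ∉ R) (hS : S ⊆ R)
    (h : ∀ s ∈ S, G.Adj v s) : edgesIn G R + S.card ≤ edgesIn G (insert v R) := by
  rw [edgesIn_insert hv]
  gcongr
  exact fun s hs => mem_nbrs.2 ⟨hS hs, h s hs⟩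

lemma edgesIn_union_ge {R S : Finset V} (h : Disjoint R S) {r s : V} (hr : r ∈ R) (hs : s ∈ S)
    (hrs : G.Adj r s) : edgesIn G R + edgesIn G S + 1 ≤ edgesIn G (R ∪ S) := by
  rw [edgesIn_union h]
  gcongr
  refine le_trans ?_ (Finset.single_le_sum (f := fun r => (nbrs G S r).card)
    (fun _ _ => Nat.zero_le _) hr)
  exact Finset.card_pos.2 ⟨s, mem_nbrs.2 ⟨hs, hrs⟩⟩

lemma edgesIn_eq_zero {R : Finset V} (h : IsIndepSet G R) : edgesIn G R = 0 := by
  have h0 : ∀ r ∈ R, (nbrs G R r).card = 0 := fun r hr =>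
    Finset.card_eq_zero.2 (Finset.filter_eq_empty_iff.2 fun {t} ht => h r hr t ht)
  have := sum_card_nbrs_self (G := G) R
  rw [Finset.sum_eq_zero h0] at this
  omega

lemma exists_third {s : Finset V} (hs : s.card = 3) {p q : V} (hp : p ∈ s)
    (hq : q ∈ s) (hpq : p ≠ q) : ∃ r, r ≠ p ∧ r ≠ q ∧ s = {p, q, r} := by
  have hq' : q ∈ s.erase p := Finset.mem_erase.2 ⟨hpq.symm, hq⟩
  obtain ⟨r, hr⟩ : ∃ r, (s.erase p).erase q = {r} := by
    rw [← Finset.card_eq_one, Finset.card_erase_of_mem hq', Finset.card_erase_of_mem hp, hs]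
  have hr' : r ∈ (s.erase p).erase q := by simp [hr]
  simp only [Finset.mem_erase] at hr'
  refine ⟨r, hr'.2.1, hr'.1, ?_⟩
  rw [← hr, Finset.insert_erase hq', Finset.insert_erase hp]

end Counting

section Difficult

open scoped Classical

variable {V : Type} (G : SimpleGraph V)

/-- The vertices `x`, `y`, `z` span a triangle. -/
def IsTri (x y z : V) : Prop := G.Adj x y ∧ G.Adj y z ∧ G.Adj x z

/-- `D` is the vertex set of a triangle, or the union of two disjoint triangles joined by
an edge. -/
def IsDifficultSet (D : Finset V) : Prop :=
  (∃ x y z, IsTri G x y z ∧ D = {x, y, z}) ∨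
  ∃ x y z u v w, IsTri G x y z ∧ IsTri G u v w ∧ G.Adj x u ∧
    Disjoint ({x, y, z} : Finset V) {u, v, w} ∧ D = {x, y, z} ∪ {u, v, w}

/-- `D` is a subset of `W` without neighbours in `W` outside `D`. -/
def IsClosedIn (W D : Finset V) : Prop :=
  D ⊆ W ∧ ∀ u ∈ D, ∀ w ∈ W, G.Adj u w → w ∈ D

/-- The vertex sets of the difficult components of the subgraph induced by `W`. -/
noncomputable def difficultSets (W : Finset V) : Finset (Finset V) :=
  W.powerset.filter fun D => IsDifficultSet G D ∧ IsClosedIn G W D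

variable {G}

lemma mem_difficultSets {W D : Finset V} :
    D ∈ difficultSets G W ↔ IsDifficultSet G D ∧ IsClosedIn G W D := by
  simp only [difficultSets, Finset.mem_filter, Finset.mem_powerset, and_iff_right_iff_imp]
  exact fun h => h.2.1

namespace IsTri

variable {x y z : V}

lemma rotate (h : IsTri G x y z) : IsTri G y z x := ⟨h.2.1, h.2.2.symm, h.1.symm⟩

lemma swap (h : IsTri G x y z) : IsTri G x z y := ⟨h.2.2, h.2.1.symm, h.1⟩

lemma card_eq (h : IsTri G x y z) : ({x, y, z} : Finset V).card = 3 :=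
  Finset.card_eq_three.2 ⟨x, y, z, h.1.ne, h.2.2.ne, h.2.1.ne, rfl⟩

lemma edgesIn_eq (h : IsTri G x y z) : edgesIn G {x, y, z} = 3 := by
  obtain ⟨h1, h2, h3⟩ := h
  rw [edgesIn_insert (by simp [h1.ne, h3.ne]), edgesIn_insert (by simp [h2.ne]),
    ← LawfulSingleton.insert_empty_eq z, edgesIn_insert (by simp)]
  simp [nbrs, Finset.filter_insert, h1, h2, h3, h2.ne, Finset.filter_singleton]

/-- A vertex adjacent to two vertices of a triangle is the third one. -/
lemma eq_of_adj (hG : ¬ HasTriangleAdjC4 G) (h : IsTri G x y z) {w : V} (hx : G.Adj w x)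
    (hy : G.Adj w y) : w = z := by
  by_contra hne
  exact hG ⟨x, z, y, y, w, h.2.2, h.2.1.symm, h.1.symm, h.2.1.symm, hy.symm, hx, h.1.ne,
    Ne.symm hne⟩

/-- No edge of a triangle lies on a 4-cycle. -/
lemma not_square (hG : ¬ HasTriangleAdjC4 G) (h : IsTri G x y z) {s t : V} (hs : G.Adj x s)
    (ht : G.Adj y t) (hst : G.Adj s t) (hsy : s ≠ y) (htx : t ≠ x) : False :=
  hG ⟨x, y, z, t, s, h.1, h.2.1, h.2.2.symm, ht, hst.symm, hs.symm, htx.symm, hsy.symm⟩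

/-- A vertex outside a triangle has at most one neighbour in it. -/
lemma card_nbrs_le_one (hG : ¬ HasTriangleAdjC4 G) (h : IsTri G x y z) {w : V}
    (hw : w ∉ ({x, y, z} : Finset V)) : (nbrs G {x, y, z} w).card ≤ 1 := by
  rw [Finset.card_le_one]
  simp only [Finset.mem_insert, Finset.mem_singleton, not_or] at hw
  intro s hs t ht
  rw [mem_nbrs] at hs ht
  simp only [Finset.mem_insert, Finset.mem_singleton] at hs ht
  have h1 := fun a b => h.eq_of_adj (w := w) hG a b
  have h2 := fun a b => h.rotate.eq_of_adj (w := w) hG a b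
  have h3 := fun a b => h.rotate.rotate.eq_of_adj (w := w) hG a b
  grind

end IsTri

lemma IsDifficultSet.nonempty {D : Finset V} (h : IsDifficultSet G D) : D.Nonempty := by
  rcases h with ⟨x, y, z, -, rfl⟩ | ⟨x, y, z, u, v, w, -, -, -, -, rfl⟩ <;> exact ⟨x, by simp⟩

/-- Difficult sets induce connected subgraphs. -/
lemma IsDifficultSet.subset_of_isClosedIn {W D D' : Finset V} (h : IsDifficultSet G D)
    (hDW : D ⊆ W) (hD' : IsClosedIn G W D') {t : V} (ht : t ∈ D) (ht' : t ∈ D') : D ⊆ D' := by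
  have key : ∀ r ∈ D', ∀ s ∈ D, G.Adj r s → s ∈ D' := fun r hr s hs => hD'.2 r hr s (hDW hs)
  rcases h with ⟨x, y, z, ⟨h1, h2, h3⟩, rfl⟩ |
    ⟨x, y, z, u, v, w, ⟨h1, h2, h3⟩, ⟨h4, h5, h6⟩, h7, -, rfl⟩
  · have := h1.symm
    have := h2.symm
    have := h3.symm
    simp only [Finset.mem_insert, Finset.mem_singleton] at key ht
    intro s hs
    simp only [Finset.mem_insert, Finset.mem_singleton] at hs
    rcases ht with rfl | rfl | rfl <;> grind
  · have := h1.symm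
    have := h2.symm
    have := h3.symm
    have := h4.symm
    have := h5.symm
    have := h6.symm
    have := h7.symm
    simp only [Finset.mem_union, Finset.mem_insert, Finset.mem_singleton] at key ht
    intro s hs
    simp only [Finset.mem_union, Finset.mem_insert, Finset.mem_singleton] at hs
    have hx : x ∈ D' := by rcases ht with (rfl | rfl | rfl) | rfl | rfl | rfl <;> grind
    have hu : u ∈ D' := key x hx u (by simp) h7
    grind

lemma eq_of_mem_difficultSets {W D D' : Finset V} (h : D ∈ difficultSets G W)
    (h' : D' ∈ difficultSets G W) {t : V} (ht : t ∈ D) (ht' : t ∈ D') : D = D' := by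
  rw [mem_difficultSets] at h h'
  exact (h.1.subset_of_isClosedIn h.2.1 h'.2 ht ht').antisymm
    (h'.1.subset_of_isClosedIn h'.2.1 h.2 ht' ht)

lemma pairwiseDisjoint_difficultSets (W : Finset V) :
    (difficultSets G W : Set (Finset V)).PairwiseDisjoint id := by
  intro D hD D' hD' hne
  rw [Function.onFun, Finset.disjoint_left]
  exact fun t ht ht' => hne (eq_of_mem_difficultSets hD hD' ht ht')

lemma difficultSets_sdiff_subset {W D : Finset V} (hD : D ∈ difficultSets G W) :
    difficultSets G (W \ D) ⊆ (difficultSets G W).erase D := by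
  intro D' hD'
  rw [mem_difficultSets] at hD hD'
  have hsub := hD'.2.1
  rw [Finset.mem_erase, mem_difficultSets]
  refine ⟨?_, hD'.1, hsub.trans Finset.sdiff_subset, fun u hu w hw huw => ?_⟩
  · rintro rfl
    obtain ⟨t, ht⟩ := hD.1.nonempty
    exact (Finset.mem_sdiff.1 (hsub ht)).2 ht
  · by_cases hwD : w ∈ D
    · have hu' := Finset.mem_sdiff.1 (hsub hu)
      exact absurd (hD.2.2 w hwD u hu'.1 huw.symm) hu'.2
    · exact hD'.2.2 u hu w (Finset.mem_sdiff.2 ⟨hw, hwD⟩) huw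

lemma card_difficultSets_sdiff {W D : Finset V} (hD : D ∈ difficultSets G W) :
    (difficultSets G (W \ D)).card + 1 ≤ (difficultSets G W).card := by
  rw [← Finset.card_erase_add_one hD]
  gcongr
  exact difficultSets_sdiff_subset hD

lemma edgesBetween_eq_zero {W D : Finset V} (hD : IsClosedIn G W D) :
    edgesBetween G D (W \ D) = 0 := by
  refine Finset.sum_eq_zero fun r hr => ?_
  rw [Finset.card_eq_zero, Finset.eq_empty_iff_forall_notMem]
  intro w hw
  rw [mem_nbrs, Finset.mem_sdiff] at hw
  exact hw.1.2 (hD.2 r hr w hw.1.1 hw.2)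

/-- If every difficult component left by the deletion of `R` receives at least `c` edges from `R`,
there are at least `c` times as many edges leaving `R` as there are such components. -/
lemma mul_card_difficultSets_le {W R : Finset V} {c : ℕ}
    (h : ∀ D ∈ difficultSets G (W \ R), c ≤ ∑ t ∈ D, (nbrs G R t).card) :
    c * (difficultSets G (W \ R)).card ≤ edgesBetween G R (W \ R) := by
  rw [edgesBetween_comm, edgesBetween]
  calc c * (difficultSets G (W \ R)).card
      = ∑ D ∈ difficultSets G (W \ R), c := by simp [mul_comm]
    _ ≤ ∑ D ∈ difficultSets G (W \ R), ∑ t ∈ D, (nbrs G R t).card := Finset.sum_le_sum h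
    _ = ∑ t ∈ (difficultSets G (W \ R)).biUnion id, (nbrs G R t).card :=
        (Finset.sum_biUnion (pairwiseDisjoint_difficultSets _)).symm
    _ ≤ _ := Finset.sum_le_sum_of_subset (Finset.biUnion_subset.2 fun D hD =>
        (mem_difficultSets.1 hD).2.1)

variable (G) in
/-- `x y z` is a triangle of the subgraph induced by `U`, in which only `x` may have
neighbours outside the triangle, and at most one of them. -/
structure IsEndTri (U : Finset V) (x y z : V) : Prop where
  tri : IsTri G x y z
  subset : {x, y, z} ⊆ U
  nbrs_x : (nbrs G U x).card ≤ 3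
  nbrs_y : nbrs G U y ⊆ {x, z}
  nbrs_z : nbrs G U z ⊆ {x, y}

lemma IsEndTri.of_chain (hG : ¬ HasTriangleAdjC4 G) {U : Finset V} {x y z u v w : V}
    (h : IsTri G x y z) (h' : IsTri G u v w) (hxu : G.Adj x u)
    (hd : Disjoint ({x, y, z} : Finset V) {u, v, w})
    (hc : IsClosedIn G U ({x, y, z} ∪ {u, v, w})) : IsEndTri G U x y z := by
  have hne : ∀ s ∈ ({x, y, z} : Finset V), ∀ t ∈ ({u, v, w} : Finset V), s ≠ t :=
    fun s hs t ht => Finset.disjoint_iff_ne.1 hd s hs t ht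
  simp only [Finset.mem_insert, Finset.mem_singleton, forall_eq_or_imp, forall_eq] at hne
  have hx : ∀ t ∈ ({v, w} : Finset V), ¬ G.Adj x t := by
    simp only [Finset.mem_insert, Finset.mem_singleton, forall_eq_or_imp, forall_eq]
    exact ⟨fun hv => hne.1.2.2 (h'.eq_of_adj hG hxu hv),
      fun hw => hne.1.2.1 (h'.swap.eq_of_adj hG hxu hw)⟩
  have hyz : ∀ s ∈ ({y, z} : Finset V), ∀ t ∈ ({u, v, w} : Finset V), ¬ G.Adj s t := by
    simp only [Finset.mem_insert, Finset.mem_singleton, forall_eq_or_imp, forall_eq]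
    refine ⟨⟨fun hu => ?_, fun hv => ?_, fun hw => ?_⟩, fun hu => ?_, fun hv => ?_, fun hw => ?_⟩
    · exact hne.2.2.1 (h.eq_of_adj hG hxu.symm hu.symm).symm
    · exact h.not_square hG hxu hv h'.1 hne.2.1.1.symm hne.1.2.1.symm
    · exact h.not_square hG hxu hw h'.2.2 hne.2.1.1.symm hne.1.2.2.symm
    · exact hne.2.1.1 (h.swap.eq_of_adj hG hxu.symm hu.symm).symm
    · exact h.swap.not_square hG hxu hv h'.1 hne.2.2.1.symm hne.1.2.1.symm
    · exact h.swap.not_square hG hxu hw h'.2.2 hne.2.2.1.symm hne.1.2.2.symm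
  refine ⟨h, Finset.subset_union_left.trans hc.1, ?_, ?_, ?_⟩
  · refine (Finset.card_le_card (t := {y, z, u}) fun t ht => ?_).trans Finset.card_le_three
    rw [mem_nbrs] at ht
    have := hc.2 x (by simp) t ht.1 ht.2
    have := ht.2.ne
    have := hx t
    simp only [Finset.mem_union, Finset.mem_insert, Finset.mem_singleton] at *
    grind
  · intro t ht
    rw [mem_nbrs] at ht
    have := hc.2 y (by simp) t ht.1 ht.2
    have := ht.2.ne
    have := hyz y (by simp) t
    simp only [Finset.mem_union, Finset.mem_insert, Finset.mem_singleton] at *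
    grind
  · intro t ht
    rw [mem_nbrs] at ht
    have := hc.2 z (by simp) t ht.1 ht.2
    have := ht.2.ne
    have := hyz z (by simp) t
    simp only [Finset.mem_union, Finset.mem_insert, Finset.mem_singleton] at *
    grind

lemma exists_isEndTri (hG : ¬ HasTriangleAdjC4 G) {U D : Finset V}
    (hD : D ∈ difficultSets G U) :
    (∃ x y z, IsEndTri G U x y z ∧ nbrs G U x ⊆ {y, z} ∧ D = {x, y, z}) ∨
    ∃ x y z u v w, IsEndTri G U x y z ∧ IsEndTri G U u v w ∧ G.Adj x u ∧
      Disjoint ({x, y, z} : Finset V) {u, v, w} ∧ D = {x, y, z} ∪ {u, v, w} := by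
  rw [mem_difficultSets] at hD
  obtain ⟨⟨x, y, z, h, rfl⟩ | ⟨x, y, z, u, v, w, h, h', hxu, hd, rfl⟩, hc⟩ := hD
  · have key : ∀ s ∈ ({x, y, z} : Finset V), nbrs G U s ⊆ ({x, y, z} : Finset V).erase s := by
      intro s hs t ht
      rw [mem_nbrs] at ht
      exact Finset.mem_erase.2 ⟨ht.2.ne', hc.2 s hs t ht.1 ht.2⟩
    have hx : nbrs G U x ⊆ {y, z} := (key x (by simp)).trans (by intro t; simp)
    refine .inl ⟨x, y, z, ⟨h, hc.1, ?_, ?_, ?_⟩, hx, rfl⟩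
    · exact (Finset.card_le_card hx).trans (Finset.card_le_two.trans (by norm_num))
    · exact (key y (by simp)).trans (by intro t; simp; grind)
    · exact (key z (by simp)).trans (by intro t; simp; grind)
  · refine .inr ⟨x, y, z, u, v, w, .of_chain hG h h' hxu hd hc,
      .of_chain hG h' h hxu.symm hd.symm ?_, hxu, hd, rfl⟩
    rwa [Finset.union_comm]

lemma IsTri.not_isTri_of_card_eq_three (hG : ¬ HasTriangleAdjC4 G) {W : Finset V} {z t u c d : V}
    (h : IsTri G t c d) (hc : c ∈ W) (hd : d ∈ W) (ht : (nbrs G W t).card = 3) (hz : z ∈ W)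
    (hu : u ∈ W) (hzc : z ≠ c) (hzd : z ≠ d) : ¬ IsTri G z t u := by
  intro htu
  obtain ⟨e, -, -, hN⟩ := exists_third ht (mem_nbrs.2 ⟨hc, h.1⟩) (mem_nbrs.2 ⟨hd, h.2.2⟩) h.2.1.ne
  have h1 : z ∈ nbrs G W t := mem_nbrs.2 ⟨hz, htu.1.symm⟩
  have h2 : u ∈ nbrs G W t := mem_nbrs.2 ⟨hu, htu.2.1⟩
  have h3 := htu.2.2.ne
  rw [hN] at h1 h2
  simp only [Finset.mem_insert, Finset.mem_singleton] at h1 h2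
  have h4 : u = c ∨ u = d := by grind
  rcases h4 with rfl | rfl
  · exact hzd (h.eq_of_adj hG htu.1 htu.2.2)
  · exact hzc (h.swap.eq_of_adj hG htu.1 htu.2.2)

/-- No difficult components exist if `v` has at most one neighbour in `U` and every end triangle
has a neighbour of `v` other than its first vertex. -/
lemma difficultSets_eq_empty_of_adj (hG : ¬ HasTriangleAdjC4 G) {U : Finset V} {v : V}
    (hv : ∀ s ∈ U, ∀ t ∈ U, G.Adj v s → G.Adj v t → s = t)
    (hend : ∀ x y z, IsEndTri G U x y z → G.Adj v y ∨ G.Adj v z) : difficultSets G U = ∅ := by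
  refine Finset.eq_empty_of_forall_notMem fun D hD => ?_
  rcases exists_isEndTri hG hD with ⟨x, y, z, h, hx, -⟩ | ⟨x, y, z, x', y', z', h, h', -, hd, -⟩
  · have hsub := h.subset
    have h1 : IsEndTri G U y z x := by
      refine ⟨h.tri.rotate, fun t ht => h.subset (by simp at ht ⊢; tauto), ?_, ?_, hx⟩
      · exact (Finset.card_le_card h.nbrs_y).trans (Finset.card_le_two.trans (by norm_num))
      · exact h.nbrs_z.trans (by intro t; simp; tauto)
    have h2 : IsEndTri G U z x y := by
      refine ⟨h1.tri.rotate, fun t ht => h1.subset (by simp at ht ⊢; tauto), ?_, ?_, ?_⟩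
      · exact (Finset.card_le_card h.nbrs_z).trans (Finset.card_le_two.trans (by norm_num))
      · exact hx.trans (by intro t; simp; tauto)
      · exact h.nbrs_y.trans (by intro t; simp; tauto)
    have hxy := hv x (hsub (by simp)) y (hsub (by simp))
    have hyz := hv y (hsub (by simp)) z (hsub (by simp))
    have hzx := hv z (hsub (by simp)) x (hsub (by simp))
    have := h.tri.1.ne
    have := h.tri.2.1.ne
    have := h.tri.2.2.ne
    have := hend _ _ _ h
    have := hend _ _ _ h1
    have := hend _ _ _ h2
    grind
  · have key : ∀ {x y z : V}, IsEndTri G U x y z →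
        ∃ t ∈ ({x, y, z} : Finset V), t ∈ U ∧ G.Adj v t := fun {x y z} h => by
      rcases hend _ _ _ h with h1 | h1
      · exact ⟨y, by simp, h.subset (by simp), h1⟩
      · exact ⟨z, by simp, h.subset (by simp), h1⟩
    obtain ⟨s, hs, hsU, hys⟩ := key h
    obtain ⟨t, ht, htU, hyt⟩ := key h'
    obtain rfl := hv s hsU t htU hys hyt
    exact Finset.disjoint_left.1 hd hs ht

end Difficult

section MinimalCounterexample

open scoped Classical

variable {V : Type} (G : SimpleGraph V) (a b : ℝ)

/-- The subgraph induced by `W` satisfies the lower bound on the independence number. -/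
def HasLargeIndepSet (W : Finset V) : Prop :=
  ∃ s ⊆ W, IsIndepSet G s ∧
    (W.card : ℝ) - (a * W.card + b * edgesIn G W + b * (difficultSets G W).card) ≤ s.card

/-- The subgraph induced by `W` is a minimal counterexample to the lower bound on the
independence number with coefficients `a` and `b`. -/
structure IsMinimalCounterexample (W : Finset V) : Prop where
  a_pos : 0 < a
  b_pos : 0 < b
  edge : 1 ≤ 2 * a + b
  three_triangles : 6 ≤ 9 * a + 11 * b
  delete_five : 1 ≤ a + 5 * b
  delete_nbhd_three : 3 ≤ 4 * a + 9 * b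
  ten_vertices : 7 ≤ 10 * a + 16 * b
  delete_nbhd_four : 4 ≤ 5 * a + 14 * b
  noTriC4 : ¬ HasTriangleAdjC4 G
  not_large : ¬ HasLargeIndepSet G a b W
  large_of_ssubset : ∀ W' ⊂ W, HasLargeIndepSet G a b W'

variable {G a b}

lemma IsIndepSet.union_of_nbrs_subset {W R I s : Finset V} (hI : IsIndepSet G I)
    (hs : IsIndepSet G s) (hsR : s ⊆ W \ R) (hN : ∀ i ∈ I, nbrs G W i ⊆ R) :
    IsIndepSet G (I ∪ s) := by
  have key : ∀ i ∈ I, ∀ t ∈ s, ¬ G.Adj i t := fun i hi t ht hit => by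
    have := Finset.mem_sdiff.1 (hsR ht)
    exact this.2 (hN i hi (mem_nbrs.2 ⟨this.1, hit⟩))
  intro v hv w hw
  rcases Finset.mem_union.1 hv with hv | hv <;> rcases Finset.mem_union.1 hw with hw | hw
  · exact hI v hv w hw
  · exact key v hv w hw
  · exact fun h => key w hw v hv h.symm
  · exact hs v hv w hw

variable (G) in
/-- `I` is an independent subset of `R`, and `R` contains all neighbours of `I` in `W`. -/
structure IsReduction (W R I : Finset V) : Prop where
  subset : R ⊆ W
  indep_subset : I ⊆ R
  indep : IsIndepSet G I
  nbrs_subset : ∀ i ∈ I, nbrs G W i ⊆ R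

lemma isIndepSet_singleton (v : V) : IsIndepSet G {v} := by
  simp [IsIndepSet]

lemma isIndepSet_pair {v w : V} (h : ¬ G.Adj v w) : IsIndepSet G {v, w} := by
  simp [IsIndepSet, h, G.adj_comm w v]

lemma isIndepSet_insert {v : V} {s : Finset V} (hs : IsIndepSet G s) (h : ∀ w ∈ s, ¬ G.Adj v w) :
    IsIndepSet G (insert v s) := by
  intro x hx y hy
  have := hs x
  have := G.adj_comm
  have := G.loopless.irrefl v
  grind

/-- The maximum independent sets of a difficult set. -/
lemma exists_indep_of_isDifficultSet (hG : ¬ HasTriangleAdjC4 G) {U D : Finset V}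
    (hD : D ∈ difficultSets G U) :
    ∃ I ⊆ D, IsIndepSet G I ∧
      (D.card = 3 ∧ edgesIn G D = 3 ∧ I.card = 1 ∨ D.card = 6 ∧ edgesIn G D = 7 ∧ I.card = 2) := by
  rcases exists_isEndTri hG hD with ⟨x, y, z, h, hx, rfl⟩ | ⟨x, y, z, u, v, w, h, h', hxu, hd, rfl⟩
  · exact ⟨{x}, by simp, isIndepSet_singleton x, .inl ⟨h.tri.card_eq, h.tri.edgesIn_eq, by simp⟩⟩
  · have hne : ∀ s ∈ ({x, y, z} : Finset V), ∀ t ∈ ({u, v, w} : Finset V), s ≠ t :=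
      fun s hs t ht => Finset.disjoint_iff_ne.1 hd s hs t ht
    simp only [Finset.mem_insert, Finset.mem_singleton, forall_eq_or_imp, forall_eq] at hne
    have hy : ∀ t ∈ ({u, v, w} : Finset V), ¬ G.Adj y t := fun t ht hyt => by
      have h1 := h.nbrs_y (mem_nbrs.2 ⟨h'.subset ht, hyt⟩)
      simp only [Finset.mem_insert, Finset.mem_singleton] at h1 ht
      grind
    have hz : ∀ t ∈ ({u, v, w} : Finset V), ¬ G.Adj z t := fun t ht hzt => by
      have h1 := h.nbrs_z (mem_nbrs.2 ⟨h'.subset ht, hzt⟩)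
      simp only [Finset.mem_insert, Finset.mem_singleton] at h1 ht
      grind
    have hx : nbrs G {u, v, w} x = {u} := by
      ext t
      rw [mem_nbrs, Finset.mem_singleton]
      refine ⟨fun ⟨ht, hxt⟩ => ?_, ?_⟩
      · by_contra htu
        simp only [Finset.mem_insert, Finset.mem_singleton] at ht
        rcases ht with rfl | rfl | rfl
        · exact htu rfl
        · exact hne.1.2.2 (h'.tri.eq_of_adj hG hxu hxt)
        · exact hne.1.2.1 (h'.tri.swap.eq_of_adj hG hxu hxt)
      · rintro rfl
        exact ⟨by simp, hxu⟩
    refine ⟨{y, v}, ?_, isIndepSet_pair (hy v (by simp)), .inr ⟨?_, ?_, ?_⟩⟩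
    · intro t
      simp only [Finset.mem_union, Finset.mem_insert, Finset.mem_singleton]
      grind
    · rw [Finset.card_union_of_disjoint hd, h.tri.card_eq, h'.tri.card_eq]
    · rw [edgesIn_union hd, h.tri.edgesIn_eq, h'.tri.edgesIn_eq]
      have hy0 : nbrs G {u, v, w} y = ∅ := Finset.filter_eq_empty_iff.2 fun t ht => hy t ht
      have hz0 : nbrs G {u, v, w} z = ∅ := Finset.filter_eq_empty_iff.2 fun t ht => hz t ht
      rw [edgesBetween, Finset.sum_insert (by simp [h.tri.1.ne, h.tri.2.2.ne]),
        Finset.sum_insert (by simp [h.tri.2.1.ne]), Finset.sum_singleton, hx, hy0, hz0]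
      simp
    · rw [Finset.card_pair hne.2.1.2.1]

lemma mem_difficultSets_sdiff {U D D' : Finset V} (hD : D ∈ difficultSets G U)
    (hD' : D' ∈ difficultSets G U) (hne : D ≠ D') : D' ∈ difficultSets G (U \ D) := by
  have h' := mem_difficultSets.1 hD'
  refine mem_difficultSets.2 ⟨h'.1, fun t ht => Finset.mem_sdiff.2 ⟨h'.2.1 ht, fun htD =>
    hne (eq_of_mem_difficultSets hD hD' htD ht)⟩, fun u hu w hw huw => ?_⟩
  exact h'.2.2 u hu w (Finset.mem_sdiff.1 hw).1 huw

/-- A reduction can be extended by a difficult component of the remaining graph. -/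
lemma IsReduction.extend (hG : ¬ HasTriangleAdjC4 G) {W R I D : Finset V}
    (h : IsReduction G W R I) (hD : D ∈ difficultSets G (W \ R)) :
    ∃ I', IsReduction G W (R ∪ D) I' ∧
      (D.card = 3 ∧ edgesIn G D = 3 ∧ I'.card = I.card + 1 ∨
        D.card = 6 ∧ edgesIn G D = 7 ∧ I'.card = I.card + 2) := by
  obtain ⟨J, hJD, hJ, hcard⟩ := exists_indep_of_isDifficultSet hG hD
  have hc := (mem_difficultSets.1 hD).2
  have hd : Disjoint R (W \ R) := Finset.disjoint_sdiff
  have hIJ : Disjoint I J := Finset.disjoint_of_subset_left h.indep_subset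
    (Finset.disjoint_of_subset_right (hJD.trans hc.1) hd)
  refine ⟨I ∪ J, ⟨Finset.union_subset h.subset (hc.1.trans Finset.sdiff_subset),
    Finset.union_subset_union h.indep_subset hJD,
    h.indep.union_of_nbrs_subset hJ (hJD.trans hc.1) h.nbrs_subset, fun i hi w hw => ?_⟩, ?_⟩
  · rw [Finset.mem_union] at hi ⊢
    rcases hi with hi | hi
    · exact .inl (h.nbrs_subset i hi hw)
    · rw [mem_nbrs] at hw
      by_cases hwR : w ∈ R
      · exact .inl hwR
      · exact .inr (hc.2 i (hJD hi) w (Finset.mem_sdiff.2 ⟨hw.1, hwR⟩) hw.2)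
  · rw [Finset.card_union_of_disjoint hIJ]
    omega

lemma disjoint_of_mem_difficultSets {W R D : Finset V}
    (hD : D ∈ difficultSets G (W \ R)) : Disjoint R D :=
  Finset.disjoint_of_subset_right (mem_difficultSets.1 hD).2.1 Finset.disjoint_sdiff

lemma IsTri.exists_of_mem {x y z r : V} (h : IsTri G x y z)
    (hr : r ∈ ({x, y, z} : Finset V)) :
    ∃ s t, IsTri G r s t ∧ ({x, y, z} : Finset V) = {r, s, t} := by
  simp only [Finset.mem_insert, Finset.mem_singleton] at hr
  rcases hr with rfl | rfl | rfl
  · exact ⟨y, z, h, rfl⟩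
  · exact ⟨z, x, h.rotate, by ext; simp; tauto⟩
  · exact ⟨x, y, h.rotate.rotate, by ext; simp; tauto⟩

lemma isDifficultSet_union {D : Finset V} {x y z t r : V} (h : IsTri G x y z)
    (hD : IsDifficultSet G D) (hD3 : D.card = 3) (hdisj : Disjoint {x, y, z} D)
    (ht : t ∈ D) (hr : r ∈ ({x, y, z} : Finset V)) (hrt : G.Adj r t) :
    IsDifficultSet G ({x, y, z} ∪ D) := by
  rcases hD with ⟨u, v, w, h', rfl⟩ | ⟨x, y, z, u, v, w, h, h', -, hd, rfl⟩
  · obtain ⟨y', z', h1, h2⟩ := h.exists_of_mem hr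
    obtain ⟨v', w', h3, h4⟩ := h'.exists_of_mem ht
    rw [h2, h4] at hdisj ⊢
    exact .inr ⟨r, y', z', t, v', w', h1, h3, hrt, hdisj, rfl⟩
  · rw [Finset.card_union_of_disjoint hd, h.card_eq, h'.card_eq] at hD3
    omega

namespace IsMinimalCounterexample

variable {W : Finset V}

/-- The basic reduction: delete `R` and put `I` into the independent set. -/
lemma reduce_aux (hW : IsMinimalCounterexample G a b W) {R I : Finset V}
    (h : IsReduction G W R I) (hR0 : R.Nonempty) :
    a * R.card + b * (edgesIn G R + edgesBetween G R (W \ R)) + b * (difficultSets G W).card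
      < R.card - I.card + b * (difficultSets G (W \ R)).card := by
  by_contra! hcon
  obtain ⟨s, hs, hsI, hsc⟩ := hW.large_of_ssubset (W \ R) (Finset.sdiff_ssubset h.subset hR0)
  refine hW.not_large ⟨I ∪ s, Finset.union_subset (h.indep_subset.trans h.subset)
    (hs.trans Finset.sdiff_subset),
    h.indep.union_of_nbrs_subset hsI hs h.nbrs_subset, ?_⟩
  have hd : Disjoint I s := Finset.disjoint_of_subset_left h.indep_subset
    (Finset.disjoint_of_subset_right hs Finset.disjoint_sdiff)
  have hc : ((W \ R).card : ℝ) = W.card - R.card := by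
    rw [Finset.card_sdiff_of_subset h.subset, Nat.cast_sub (Finset.card_le_card h.subset)]
  rw [Finset.card_union_of_disjoint hd, edgesIn_eq_add_sdiff h.subset]
  rw [hc] at hsc
  push_cast
  linarith

lemma two_le (hW : IsMinimalCounterexample G a b W) : 2 ≤ 3 * a + 4 * b := by
  linarith [hW.three_triangles, hW.b_pos]

/-- A minimal counterexample has no difficult components. -/
lemma difficultSets_eq_empty (hW : IsMinimalCounterexample G a b W) : difficultSets G W = ∅ := by
  by_contra hne
  obtain ⟨D, hD⟩ := Finset.nonempty_iff_ne_empty.2 hne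
  obtain ⟨I, hID, hI, hcard⟩ := exists_indep_of_isDifficultSet hW.noTriC4 hD
  have hD' := mem_difficultSets.1 hD
  have hred := hW.reduce_aux ⟨hD'.2.1, hID, hI, fun i hi w hw =>
    hD'.2.2 i (hID hi) w (mem_nbrs.1 hw).1 (mem_nbrs.1 hw).2⟩ hD'.1.nonempty
  have hc : ((difficultSets G (W \ D)).card : ℝ) + 1 ≤ (difficultSets G W).card :=
    mod_cast card_difficultSets_sdiff hD
  have hmul := mul_le_mul_of_nonneg_left hc hW.b_pos.le
  have h2 := hW.two_le
  rw [edgesBetween_eq_zero hD'.2] at hred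
  rcases hcard with ⟨h3, h4, h5⟩ | ⟨h3, h4, h5⟩ <;>
    rw [h3, h4, h5] at hred <;> push_cast at hred <;>
    linarith

/-- Deleting `R` and putting `I` into the independent set removes too few edges. -/
lemma reduce (hW : IsMinimalCounterexample G a b W) {R I : Finset V}
    (h : IsReduction G W R I) (hR0 : R.Nonempty)
    {m : ℕ} (hm : m + (difficultSets G (W \ R)).card ≤
      edgesIn G R + edgesBetween G R (W \ R)) :
    a * R.card + b * m < R.card - I.card := by
  have h := hW.reduce_aux h hR0
  have hm' : (m : ℝ) + (difficultSets G (W \ R)).card ≤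
      edgesIn G R + edgesBetween G R (W \ R) := mod_cast hm
  have hmul := mul_le_mul_of_nonneg_left hm' hW.b_pos.le
  rw [hW.difficultSets_eq_empty, Finset.card_empty, Nat.cast_zero] at h
  linarith

/-- Every difficult component arising by the deletion of `R` has a neighbour in `R`. -/
lemma exists_adj (hW : IsMinimalCounterexample G a b W) {R D : Finset V}
    (hD : D ∈ difficultSets G (W \ R)) : ∃ t ∈ D, ∃ r ∈ R, G.Adj t r := by
  by_contra! hcon
  have hD' := mem_difficultSets.1 hD
  have : D ∈ difficultSets G W := by
    refine mem_difficultSets.2 ⟨hD'.1, hD'.2.1.trans Finset.sdiff_subset, fun u hu w hw huw => ?_⟩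
    exact hD'.2.2 u hu w (Finset.mem_sdiff.2 ⟨hw, fun hwR => hcon u hu w hwR huw⟩) huw
  simp [hW.difficultSets_eq_empty] at this

lemma card_difficultSets_le (hW : IsMinimalCounterexample G a b W) (R : Finset V) :
    (difficultSets G (W \ R)).card ≤ edgesBetween G R (W \ R) := by
  rw [← one_mul (difficultSets G (W \ R)).card]
  refine mul_card_difficultSets_le fun D hD => ?_
  obtain ⟨t, ht, r, hr, htr⟩ := hW.exists_adj hD
  refine le_trans ?_ (Finset.single_le_sum (f := fun t => (nbrs G R t).card)
    (fun _ _ => Nat.zero_le _) ht)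
  exact Finset.card_pos.2 ⟨r, mem_nbrs.2 ⟨hr, htr⟩⟩

/-- A version of `reduce` that only counts the edges inside `R`. -/
lemma reduce_inner (hW : IsMinimalCounterexample G a b W) {R I : Finset V}
    (h : IsReduction G W R I) (hR0 : R.Nonempty)
    {m : ℕ} (hm : m ≤ edgesIn G R) : a * R.card + b * m < R.card - I.card :=
  hW.reduce h hR0 (add_le_add hm (hW.card_difficultSets_le R))

lemma two_le_card_nbrs (hW : IsMinimalCounterexample G a b W) {v : V} (hv : v ∈ W) :
    2 ≤ (nbrs G W v).card := by
  by_contra hlt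
  have h01 : (nbrs G W v).card = 0 ∨ (nbrs G W v).card = 1 := by omega
  rcases h01 with h0 | h1
  · rw [Finset.card_eq_zero] at h0
    have := hW.reduce_inner (R := {v}) (I := {v}) ⟨by simpa using hv, subset_rfl,
      isIndepSet_singleton v, by simp [h0]⟩ (by simp) (Nat.zero_le _)
    simp only [Finset.card_singleton] at this
    push_cast at this
    linarith [hW.a_pos]
  · obtain ⟨u, hu⟩ := Finset.card_eq_one.1 h1
    have hu' : u ∈ nbrs G W v := by simp [hu]
    rw [mem_nbrs] at hu'
    have he : 0 + 1 ≤ edgesIn G {v, u} := by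
      refine le_trans ?_ (edgesIn_insert_ge (S := {u}) (by simpa using hu'.2.ne) subset_rfl
        (by simpa using hu'.2))
      simp
    have := hW.reduce_inner (R := {v, u}) (I := {v}) ⟨by simp [Finset.insert_subset_iff, hv, hu'],
      by simp, isIndepSet_singleton v, by simp [hu]⟩ (by simp) he
    rw [Finset.card_pair hu'.2.ne] at this
    simp only [Finset.card_singleton] at this
    push_cast at this
    linarith [hW.edge]

lemma three_le_card_nbrs_of_isTri (hW : IsMinimalCounterexample G a b W) {x y z : V}
    (h : IsTri G x y z) (hsub : {x, y, z} ⊆ W) : 3 ≤ (nbrs G W z).card := by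
  by_contra hlt
  have hG := hW.noTriC4
  set T : Finset V := {x, y, z} with hT
  have hz : nbrs G W z = {x, y} := by
    refine (Finset.eq_of_subset_of_card_le (fun t ht => ?_) ?_).symm
    · simp only [Finset.mem_insert, Finset.mem_singleton] at ht
      rw [mem_nbrs]
      rcases ht with rfl | rfl
      · exact ⟨hsub (by simp [hT]), h.2.2.symm⟩
      · exact ⟨hsub (by simp [hT]), h.2.1.symm⟩
    · rw [Finset.card_pair h.1.ne]
      omega
  have hred : IsReduction G W T {z} := ⟨hsub, by simp [hT], isIndepSet_singleton z, by
    simp only [Finset.mem_singleton, forall_eq, hz, hT]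
    intro t
    simp
    tauto⟩
  have hT0 : T.Nonempty := ⟨x, by simp [hT]⟩
  have hTc : T.card = 3 := h.card_eq
  have hTe : edgesIn G T = 3 := h.edgesIn_eq
  have hle : edgesBetween G T (W \ T) ≤ (difficultSets G (W \ T)).card := by
    by_contra hcon
    have := hW.reduce hred hT0 (m := 4) (by omega)
    rw [hTc, Finset.card_singleton] at this
    push_cast at this
    linarith [hW.two_le]
  have hnotmem : ∀ D, IsDifficultSet G D → D ⊆ W → ∃ u ∈ D, ∃ w ∈ W, G.Adj u w ∧ w ∉ D := by
    intro D hD hDW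
    by_contra! hcon
    have : D ∈ difficultSets G W := mem_difficultSets.2 ⟨hD, hDW, hcon⟩
    simp [hW.difficultSets_eq_empty] at this
  have hpos : 0 < edgesBetween G T (W \ T) := by
    obtain ⟨u, hu, w, hw, huw, hwT⟩ := hnotmem T (.inl ⟨x, y, z, h, rfl⟩) hsub
    exact Finset.sum_pos' (fun _ _ => Nat.zero_le _) ⟨u, hu, Finset.card_pos.2
      ⟨w, mem_nbrs.2 ⟨Finset.mem_sdiff.2 ⟨hw, hwT⟩, huw⟩⟩⟩
  have hunion : ∀ D ∈ difficultSets G (W \ T), edgesIn G T + edgesIn G D + 1 ≤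
      edgesIn G (T ∪ D) := by
    intro D hD
    obtain ⟨t, ht, r, hr, htr⟩ := hW.exists_adj hD
    exact edgesIn_union_ge (disjoint_of_mem_difficultSets hD) hr ht htr.symm
  have h3 : ∀ D ∈ difficultSets G (W \ T), D.card = 3 ∧ edgesIn G D = 3 := by
    intro D hD
    have hu := hunion D hD
    obtain ⟨I, hI, ⟨hc, he, hi⟩ | ⟨hc, he, hi⟩⟩ := hred.extend hG hD
    · exact ⟨hc, he⟩
    · have := hW.reduce_inner hI (hT0.mono Finset.subset_union_left) (m := 11) (by omega)
      rw [Finset.card_union_of_disjoint (disjoint_of_mem_difficultSets hD), hTc, hc, hi,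
        Finset.card_singleton] at this
      push_cast at this
      linarith [hW.three_triangles]
  have hsub1 : ∀ D ∈ difficultSets G (W \ T), ∀ D' ∈ difficultSets G (W \ T), D = D' := by
    intro D hD D' hD'
    by_contra hne
    have hu := hunion D hD
    obtain ⟨hc, he⟩ := h3 D hD
    obtain ⟨hc', he'⟩ := h3 D' hD'
    obtain ⟨t, ht, r, hr, htr⟩ := hW.exists_adj hD'
    have hD'' : D' ∈ difficultSets G (W \ (T ∪ D)) := by
      have := mem_difficultSets_sdiff hD hD' hne
      rwa [sdiff_sdiff_left] at this
    obtain ⟨I, hI, hi⟩ := hred.extend hG hD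
    obtain ⟨I', hI', hi'⟩ := hI.extend hG hD''
    have hu' := edgesIn_union_ge (disjoint_of_mem_difficultSets hD'')
      (Finset.mem_union_left D hr) ht htr.symm
    have := hW.reduce_inner hI' (hT0.mono (Finset.subset_union_left.trans
      Finset.subset_union_left)) (m := 11) (by omega)
    have hi2 : I'.card = 3 := by
      rw [Finset.card_singleton] at hi
      omega
    rw [Finset.card_union_of_disjoint (disjoint_of_mem_difficultSets hD''),
      Finset.card_union_of_disjoint (disjoint_of_mem_difficultSets hD), hTc, hc, hc', hi2] at this
    push_cast at this
    linarith [hW.three_triangles]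
  have hle1 : edgesBetween G T (W \ T) ≤ 1 := hle.trans (Finset.card_le_one.2 hsub1)
  obtain ⟨D, hD⟩ := Finset.card_pos.1 (hpos.trans_le hle)
  have hD' := mem_difficultSets.1 hD
  obtain ⟨t, ht, r, hr, htr⟩ := hW.exists_adj hD
  obtain ⟨u, hu, w, hw, huw, hwTD⟩ := hnotmem _ (isDifficultSet_union h hD'.1 (h3 D hD).1
    (disjoint_of_mem_difficultSets hD) ht hr htr.symm)
    (Finset.union_subset hsub (hD'.2.1.trans Finset.sdiff_subset))
  simp only [Finset.mem_union, not_or] at hu hwTD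
  have hwW : w ∈ W \ T := Finset.mem_sdiff.2 ⟨hw, hwTD.1⟩
  have huT : u ∈ T := hu.resolve_right fun huD => hwTD.2 (hD'.2.2 u huD w hwW huw)
  have h2 : ∑ s ∈ ({t, w} : Finset V), (nbrs G T s).card ≤ edgesBetween G T (W \ T) := by
    rw [edgesBetween_comm]
    refine Finset.sum_le_sum_of_subset ?_
    simp [Finset.insert_subset_iff, hwW, hD'.2.1 ht, -Finset.mem_sdiff]
  rw [Finset.sum_pair (by rintro rfl; exact hwTD.2 ht)] at h2
  have ht1 : 0 < (nbrs G T t).card := Finset.card_pos.2 ⟨r, mem_nbrs.2 ⟨hr, htr⟩⟩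
  have hw1 : 0 < (nbrs G T w).card := Finset.card_pos.2 ⟨u, mem_nbrs.2 ⟨huT, huw.symm⟩⟩
  omega

lemma one_le_card_nbrs (hW : IsMinimalCounterexample G a b W) {R : Finset V} (hR : R ⊆ W)
    {x y z : V} (h : IsTri G x y z) (hsub : {x, y, z} ⊆ W \ R)
    (hx : nbrs G (W \ R) x ⊆ {y, z}) : 1 ≤ (nbrs G R x).card := by
  have h3 := hW.three_le_card_nbrs_of_isTri h.rotate
    (fun t ht => (Finset.mem_sdiff.1 (hsub (by simp at ht ⊢; tauto))).1)
  have h2 := (Finset.card_le_card hx).trans Finset.card_le_two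
  rw [card_nbrs_sdiff hR] at h3
  omega

/-- A difficult component left by the deletion of `R` is either a triangle each of whose vertices
has a neighbour in `R`, or it has six vertices and receives at least four edges from `R`. -/
lemma difficult_cases (hW : IsMinimalCounterexample G a b W) {R D : Finset V} (hR : R ⊆ W)
    (hD : D ∈ difficultSets G (W \ R)) :
    (∃ x y z, IsEndTri G (W \ R) x y z ∧ D = {x, y, z} ∧ ∀ t ∈ D, 1 ≤ (nbrs G R t).card) ∨
    D.card = 6 ∧ 4 ≤ ∑ t ∈ D, (nbrs G R t).card := by
  have key : ∀ {x y z : V}, IsEndTri G (W \ R) x y z →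
      1 ≤ (nbrs G R y).card ∧ 1 ≤ (nbrs G R z).card := fun {x y z} h => by
    refine ⟨hW.one_le_card_nbrs hR h.tri.rotate.swap ?_ h.nbrs_y,
      hW.one_le_card_nbrs hR h.tri.rotate.rotate ?_ h.nbrs_z⟩
    · exact fun t ht => h.subset (by simp at ht ⊢; tauto)
    · exact fun t ht => h.subset (by simp at ht ⊢; tauto)
  rcases exists_isEndTri hW.noTriC4 hD with ⟨x, y, z, h, hx, rfl⟩ |
    ⟨x, y, z, u, v, w, h, h', hxu, hd, rfl⟩
  · refine .inl ⟨x, y, z, h, rfl, ?_⟩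
    simp only [Finset.mem_insert, Finset.mem_singleton, forall_eq_or_imp, forall_eq]
    exact ⟨hW.one_le_card_nbrs hR h.tri h.subset hx, key h⟩
  · refine .inr ⟨by rw [Finset.card_union_of_disjoint hd, h.tri.card_eq, h'.tri.card_eq], ?_⟩
    rw [Finset.sum_union hd, Finset.sum_insert (by simp [h.tri.1.ne, h.tri.2.2.ne]),
      Finset.sum_pair h.tri.2.1.ne, Finset.sum_insert (by simp [h'.tri.1.ne, h'.tri.2.2.ne]),
      Finset.sum_pair h'.tri.2.1.ne]
    have := key h
    have := key h'
    omega

lemma three_mul_card_difficultSets_le (hW : IsMinimalCounterexample G a b W) {R : Finset V}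
    (hR : R ⊆ W) : 3 * (difficultSets G (W \ R)).card ≤ edgesBetween G R (W \ R) := by
  refine mul_card_difficultSets_le fun D hD => ?_
  rcases hW.difficult_cases hR hD with ⟨x, y, z, h, rfl, h1⟩ | ⟨-, h4⟩
  · rw [← h.tri.card_eq, Finset.card_eq_sum_ones]
    exact Finset.sum_le_sum h1
  · exact le_trans (by norm_num) h4

lemma four_mul_card_difficultSets_le (hW : IsMinimalCounterexample G a b W) {R : Finset V}
    (hR : R ⊆ W) (h6 : ∀ D ∈ difficultSets G (W \ R), D.card = 6) :
    4 * (difficultSets G (W \ R)).card ≤ edgesBetween G R (W \ R) := by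
  refine mul_card_difficultSets_le fun D hD => ?_
  rcases hW.difficult_cases hR hD with ⟨x, y, z, h, rfl, h1⟩ | ⟨-, h4⟩
  · have := h6 _ hD
    rw [h.tri.card_eq] at this
    omega
  · exact h4

lemma add_mul_card_nbrs_lt_one (hW : IsMinimalCounterexample G a b W) {v : V} (hv : v ∈ W) :
    a + b * (nbrs G W v).card < 1 := by
  have hR : ({v} : Finset V) ⊆ W := by simpa using hv
  have hvn : ∀ {x y z : V}, IsTri G x y z → {x, y, z} ⊆ W \ {v} → G.Adj y v → G.Adj z v →
      False := fun {x y z} h hsub hy hz => by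
    have := h.rotate.eq_of_adj hW.noTriC4 hy.symm hz.symm
    exact (Finset.mem_sdiff.1 (hsub (Finset.mem_insert_self x _))).2 (by simp [this])
  have hend : ∀ {x y z : V}, IsEndTri G (W \ {v}) x y z → False := fun {x y z} h => by
    have hy := hW.one_le_card_nbrs hR h.tri.rotate.swap
      (fun t ht => h.subset (by simp at ht ⊢; tauto)) h.nbrs_y
    have hz := hW.one_le_card_nbrs hR h.tri.rotate.rotate
      (fun t ht => h.subset (by simp at ht ⊢; tauto)) h.nbrs_z
    obtain ⟨s, hs⟩ := Finset.card_pos.1 hy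
    obtain ⟨t, ht⟩ := Finset.card_pos.1 hz
    rw [mem_nbrs, Finset.mem_singleton] at hs ht
    obtain ⟨rfl, hs⟩ := hs
    obtain ⟨rfl, ht⟩ := ht
    exact hvn h.tri h.subset hs ht
  have hempty : difficultSets G (W \ {v}) = ∅ := by
    refine Finset.eq_empty_of_forall_notMem fun D hD => ?_
    rcases exists_isEndTri hW.noTriC4 hD with ⟨x, y, z, h, -⟩ | ⟨x, y, z, u, v, w, h, -⟩
    · exact hend h
    · exact hend h
  have hsum := sum_card_nbrs (G := G) hR
  rw [Finset.sum_singleton] at hsum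
  have he : edgesIn G {v} = 0 := by
    rw [← LawfulSingleton.insert_empty_eq v, edgesIn_insert (by simp)]
    simp [nbrs]
  have := hW.reduce (R := {v}) (I := ∅) ⟨hR, by simp, by simp [IsIndepSet], by simp⟩ (by simp)
    (m := (nbrs G W v).card) (by simp only [hempty, Finset.card_empty]; omega)
  simpa using this

lemma card_nbrs_le_four (hW : IsMinimalCounterexample G a b W) {v : V} (hv : v ∈ W) :
    (nbrs G W v).card ≤ 4 := by
  by_contra hlt
  have h5 : (5 : ℝ) ≤ (nbrs G W v).card := by
    have : 5 ≤ (nbrs G W v).card := by omega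
    exact_mod_cast this
  have := mul_le_mul_of_nonneg_left h5 hW.b_pos.le
  linarith [hW.add_mul_card_nbrs_lt_one hv, hW.delete_five]

lemma notMem_nbrs_self (v : V) : v ∉ nbrs G W v := by simp [mem_nbrs]

lemma isReduction_closedNbhd {v : V} (hv : v ∈ W) :
    IsReduction G W (insert v (nbrs G W v)) {v} :=
  ⟨Finset.insert_subset hv (Finset.filter_subset _ _), by simp, isIndepSet_singleton v, by simp⟩

lemma edgesIn_closedNbhd (v : V) :
    edgesIn G (insert v (nbrs G W v)) = edgesIn G (nbrs G W v) + (nbrs G W v).card := by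
  rw [edgesIn_insert (notMem_nbrs_self v)]
  congr 2
  ext t
  simp [mem_nbrs]

/-- A triangle outside the closed neighbourhood of `v` receives at most one edge from each
neighbour of `v`. -/
lemma sum_card_nbrs_closedNbhd_le (hG : ¬ HasTriangleAdjC4 G) {v x y z : V} (h : IsTri G x y z)
    (hsub : {x, y, z} ⊆ W \ insert v (nbrs G W v)) :
    ∑ t ∈ {x, y, z}, (nbrs G (insert v (nbrs G W v)) t).card ≤ (nbrs G W v).card := by
  have h1 := edgesBetween_comm (G := G) {x, y, z} (insert v (nbrs G W v))
  have hv0 : nbrs G {x, y, z} v = ∅ := by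
    refine Finset.eq_empty_of_forall_notMem fun t ht => ?_
    rw [mem_nbrs] at ht
    have := Finset.mem_sdiff.1 (hsub ht.1)
    exact this.2 (Finset.mem_insert_of_mem (mem_nbrs.2 ⟨this.1, ht.2⟩))
  rw [edgesBetween, edgesBetween, Finset.sum_insert (notMem_nbrs_self v), hv0] at h1
  rw [h1, Finset.card_empty, zero_add, Finset.card_eq_sum_ones]
  refine Finset.sum_le_sum fun r hr => h.card_nbrs_le_one hG fun hr' => ?_
  exact (Finset.mem_sdiff.1 (hsub hr')).2 (Finset.mem_insert_of_mem hr)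

lemma three_le_card_nbrs (hW : IsMinimalCounterexample G a b W) {v : V} (hv : v ∈ W) :
    3 ≤ (nbrs G W v).card := by
  by_contra hlt
  have h2 : (nbrs G W v).card = 2 := by
    have := hW.two_le_card_nbrs hv
    omega
  have hred := isReduction_closedNbhd (G := G) hv
  set R := insert v (nbrs G W v) with hRdef
  have hind : IsIndepSet G (nbrs G W v) := by
    intro s hs t ht hst
    rw [mem_nbrs] at hs ht
    have := hW.three_le_card_nbrs_of_isTri (x := s) (y := t) (z := v)
      ⟨hst, ht.2.symm, hs.2.symm⟩ (by simp [Finset.insert_subset_iff, *])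
    omega
  have he : edgesIn G R = 2 := by
    rw [hRdef, edgesIn_closedNbhd, edgesIn_eq_zero hind, h2]
  have hsum := sum_card_nbrs (G := G) hred.subset
  rw [Finset.sum_insert (notMem_nbrs_self v), he, h2] at hsum
  have hge : 2 * 2 ≤ ∑ t ∈ nbrs G W v, (nbrs G W t).card := by
    calc 2 * 2 = ∑ t ∈ nbrs G W v, 2 := by simp [h2]
      _ ≤ _ := Finset.sum_le_sum fun t ht => hW.two_le_card_nbrs (mem_nbrs.1 ht).1
  have h4 := hW.four_mul_card_difficultSets_le hred.subset fun D hD => by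
    rcases hW.difficult_cases hred.subset hD with ⟨x, y, z, h, rfl, h1⟩ | ⟨h6, -⟩
    · have h3 := sum_card_nbrs_closedNbhd_le hW.noTriC4 h.tri h.subset
      rw [← hRdef] at h3
      have h3' : 3 ≤ ∑ t ∈ {x, y, z}, (nbrs G R t).card := by
        rw [← h.tri.card_eq, Finset.card_eq_sum_ones]
        exact Finset.sum_le_sum h1
      omega
    · exact h6
  have := hW.reduce hred (by simp [hRdef]) (m := 4) (by omega)
  rw [hRdef, Finset.card_insert_of_notMem (notMem_nbrs_self v), h2, Finset.card_singleton] at this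
  push_cast at this
  linarith [hW.two_le]

lemma add_three_mul_lt_one (hW : IsMinimalCounterexample G a b W) (hne : W.Nonempty) :
    a + 3 * b < 1 := by
  obtain ⟨v, hv⟩ := hne
  have h3 : (3 : ℝ) ≤ (nbrs G W v).card := mod_cast hW.three_le_card_nbrs hv
  have := mul_le_mul_of_nonneg_left h3 hW.b_pos.le
  linarith [hW.add_mul_card_nbrs_lt_one hv]

lemma nonempty (hW : IsMinimalCounterexample G a b W) : W.Nonempty := by
  by_contra hne
  rw [Finset.not_nonempty_iff_eq_empty] at hne
  subst hne
  refine hW.not_large ⟨∅, subset_rfl, by simp [IsIndepSet], ?_⟩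
  simp [hW.difficultSets_eq_empty]

/-- The neighbourhood of a vertex induces a matching. -/
lemma two_mul_edgesIn_nbrs_le (hG : ¬ HasTriangleAdjC4 G) (v : V) :
    2 * edgesIn G (nbrs G W v) ≤ (nbrs G W v).card := by
  rw [← sum_card_nbrs_self, Finset.card_eq_sum_ones]
  refine Finset.sum_le_sum fun u hu => Finset.card_le_one.2 fun s hs t ht => ?_
  simp only [mem_nbrs] at hu hs ht
  exact (IsTri.eq_of_adj (x := v) (y := u) hG ⟨hu.2, ht.2, ht.1.2⟩ hs.1.2.symm hs.2.symm)

/-- A vertex of degree 3 whose closed neighbourhood leaves no difficult triangle meets few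
edges with its closed neighbourhood. -/
lemma closedNbhd_edges_le (hW : IsMinimalCounterexample G a b W) {v : V} (hv : v ∈ W)
    (h3 : (nbrs G W v).card = 3)
    (h6 : ∀ D ∈ difficultSets G (W \ insert v (nbrs G W v)), D.card = 6) :
    edgesIn G (insert v (nbrs G W v)) +
      edgesBetween G (insert v (nbrs G W v)) (W \ insert v (nbrs G W v)) ≤ 8 := by
  by_contra hlt
  have hred := isReduction_closedNbhd (G := G) hv
  have he := edgesIn_closedNbhd (G := G) (W := W) v
  have hRc : (insert v (nbrs G W v)).card = 4 := by
    rw [Finset.card_insert_of_notMem (notMem_nbrs_self v), h3]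
  have hR0 : (insert v (nbrs G W v)).Nonempty := by simp
  set R := insert v (nbrs G W v) with hRdef
  have h4 := hW.four_mul_card_difficultSets_le hred.subset h6
  have hlt' : ¬ 9 + (difficultSets G (W \ R)).card ≤
      edgesIn G R + edgesBetween G R (W \ R) := fun hle => by
    have := hW.reduce hred hR0 hle
    rw [hRc, Finset.card_singleton] at this
    push_cast at this
    linarith [hW.delete_nbhd_three]
  obtain ⟨D, hD⟩ : (difficultSets G (W \ R)).Nonempty := Finset.card_pos.1 (by omega)
  have hDc := h6 D hD
  have hdisj := disjoint_of_mem_difficultSets hD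
  obtain ⟨I, hI, hcard⟩ := hred.extend hW.noTriC4 hD
  rw [Finset.card_singleton] at hcard
  have e1 := edgesIn_eq_add_sdiff (G := G) hred.subset
  have e2 := edgesIn_eq_add_sdiff (G := G) (mem_difficultSets.1 hD).2.1
  have e3 := edgesIn_eq_add_sdiff (G := G) hI.subset
  have e4 := edgesBetween_eq_zero (mem_difficultSets.1 hD).2
  have l1 := card_difficultSets_sdiff hD
  have hsd : (W \ R) \ D = W \ (R ∪ D) := sdiff_sdiff_left
  rw [hsd] at e2 e4 l1
  have hIc : I.card = 3 := by omega
  have := hW.reduce hI (hR0.mono Finset.subset_union_left) (m := 16) (by omega)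
  rw [Finset.card_union_of_disjoint hdisj, hRc, hDc, hIc] at this
  push_cast at this
  linarith [hW.ten_vertices]

/-- A difficult triangle left by the closed neighbourhood of a vertex of degree 3 is matched to
its neighbours. -/
lemma exists_matching (hW : IsMinimalCounterexample G a b W) {v : V} (hv : v ∈ W)
    (h3 : (nbrs G W v).card = 3) {D : Finset V}
    (hD : D ∈ difficultSets G (W \ insert v (nbrs G W v))) (h6 : D.card ≠ 6) :
    ∃ x y z x' y' z', nbrs G W v = {x, y, z} ∧ IsTri G x' y' z' ∧ D = {x', y', z'} ∧
      G.Adj x x' ∧ G.Adj y y' ∧ G.Adj z z' := by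
  have hred := isReduction_closedNbhd (G := G) hv
  rcases hW.difficult_cases hred.subset hD with ⟨x', y', z', h, rfl, h1⟩ | ⟨h, -⟩
  swap
  · exact absurd h h6
  have key : ∀ t ∈ ({x', y', z'} : Finset V), ∃ s ∈ nbrs G W v, G.Adj s t := by
    intro t ht
    obtain ⟨s, hs⟩ := Finset.card_pos.1 (h1 t ht)
    rw [mem_nbrs, Finset.mem_insert] at hs
    rcases hs with ⟨rfl | hs, hst⟩
    · have := Finset.mem_sdiff.1 (h.subset ht)
      exact absurd (Finset.mem_insert_of_mem (mem_nbrs.2 ⟨this.1, hst.symm⟩)) this.2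
    · exact ⟨s, hs, hst.symm⟩
  have hout : ∀ s ∈ nbrs G W v, s ∉ ({x', y', z'} : Finset V) := fun s hs hs' =>
    (Finset.mem_sdiff.1 (h.subset hs')).2 (Finset.mem_insert_of_mem hs)
  obtain ⟨x, hx, hxx⟩ := key x' (by simp)
  obtain ⟨y, hy, hyy⟩ := key y' (by simp)
  obtain ⟨z, hz, hzz⟩ := key z' (by simp)
  have hxy : x ≠ y := by
    rintro rfl
    exact hout x hx (by simp [h.tri.eq_of_adj hW.noTriC4 hxx hyy])
  have hxz : x ≠ z := by
    rintro rfl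
    exact hout x hx (by simp [h.tri.swap.eq_of_adj hW.noTriC4 hxx hzz])
  have hyz : y ≠ z := by
    rintro rfl
    exact hout y hy (by simp [h.tri.rotate.eq_of_adj hW.noTriC4 hyy hzz])
  refine ⟨x, y, z, x', y', z', ?_, h.tri, rfl, hxx, hyy, hzz⟩
  refine (Finset.eq_of_subset_of_card_le (by simp [Finset.insert_subset_iff, hx, hy, hz]) ?_).symm
  rw [h3, Finset.card_eq_three.2 ⟨x, y, z, hxy, hxz, hyz, rfl⟩]

lemma false_of_matching (hW : IsMinimalCounterexample G a b W) {v x y z x' y' z' : V} (hv : v ∈ W)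
    (h3 : (nbrs G W v).card = 3) (hind : IsIndepSet G (nbrs G W v)) (hN : nbrs G W v = {x, y, z})
    (hD : IsClosedIn G (W \ insert v (nbrs G W v)) {x', y', z'}) (h : IsTri G x' y' z')
    (hxx : G.Adj x x') (hyy : G.Adj y y') (hzz : G.Adj z z')
    (hx3 : (nbrs G W x).card = 3) (hy3 : (nbrs G W y).card = 3) : False := by
  have hG := hW.noTriC4
  have hR := (isReduction_closedNbhd (G := G) hv).subset
  have hmem : ∀ t, t ∈ nbrs G W v ↔ t = x ∨ t = y ∨ t = z := by simp [hN]
  have hxN := (hmem x).2 (by simp)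
  have hyN := (hmem y).2 (by simp)
  have hzN := (hmem z).2 (by simp)
  have hdisj : Disjoint (insert v (nbrs G W v)) {x', y', z'} :=
    Finset.disjoint_of_subset_right hD.1 Finset.disjoint_sdiff
  have hne : ∀ s ∈ insert v (nbrs G W v), ∀ t ∈ ({x', y', z'} : Finset V), s ≠ t :=
    fun s hs t ht => Finset.disjoint_iff_ne.1 hdisj s hs t ht
  have hDW : {x', y', z'} ⊆ W := hD.1.trans Finset.sdiff_subset
  have he : edgesIn G (insert v (nbrs G W v)) = 3 := by
    rw [edgesIn_closedNbhd, edgesIn_eq_zero hind, h3]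
  have hRc : (insert v (nbrs G W v)).card = 4 := by
    rw [Finset.card_insert_of_notMem (notMem_nbrs_self v), h3]
  have hne3 : x ≠ y ∧ x ≠ z ∧ y ≠ z := by
    rw [hN] at h3
    refine ⟨?_, ?_, ?_⟩ <;> rintro rfl <;> simp at h3 <;>
      exact absurd h3 (ne_of_lt (Finset.card_le_two.trans_lt (by norm_num)))
  set R := insert v (nbrs G W v) with hRdef
  set S := R ∪ {x', y', z'} with hSdef
  have hvR : v ∈ R := by simp [hRdef]
  have hNR : ∀ t ∈ nbrs G W v, t ∈ R := fun t ht => Finset.mem_insert_of_mem ht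
  have hS9 : 9 ≤ edgesIn G S := by
    rw [hSdef, edgesIn_union hdisj, he, h.edgesIn_eq, edgesBetween_comm]
    have : 3 ≤ edgesBetween G {x', y', z'} R := by
      rw [← h.card_eq, Finset.card_eq_sum_ones]
      refine Finset.sum_le_sum fun t ht => Finset.card_pos.2 ?_
      simp only [Finset.mem_insert, Finset.mem_singleton] at ht
      rcases ht with rfl | rfl | rfl
      · exact ⟨x, mem_nbrs.2 ⟨hNR x hxN, hxx.symm⟩⟩
      · exact ⟨y, mem_nbrs.2 ⟨hNR y hyN, hyy.symm⟩⟩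
      · exact ⟨z, mem_nbrs.2 ⟨hNR z hzN, hzz.symm⟩⟩
    omega
  have hSc : S.card = 7 := by
    rw [hSdef, Finset.card_union_of_disjoint hdisj, hRc, h.card_eq]
  have hSW : S ⊆ W := Finset.union_subset hR hDW
  have hfresh : ∀ {p p' q r s : V}, p ∈ nbrs G W v → G.Adj p p' → IsTri G p' q r →
      ({x', y', z'} : Finset V) = {p', q, r} → s ≠ v → s ≠ p' → G.Adj p s → s ∉ S := by
    intro p p' q r s hp hpp ht hset hsv hsp hps hsS
    rw [hSdef, hRdef, Finset.mem_union, Finset.mem_insert] at hsS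
    rw [hset] at hsS hne
    rcases hsS with (hs | hs) | hs
    · exact hsv hs
    · exact hind p hp s hs hps
    · simp only [Finset.mem_insert, Finset.mem_singleton] at hs
      rcases hs with rfl | rfl | rfl
      · exact hsp rfl
      · exact hne p (hNR p hp) r (by simp) (ht.eq_of_adj hG hpp hps)
      · exact hne p (hNR p hp) q (by simp) (ht.swap.eq_of_adj hG hpp hps)
  obtain ⟨x₂, hx1, hx2, hx⟩ := exists_third hx3 (p := v) (q := x')
    (mem_nbrs.2 ⟨hv, (mem_nbrs.1 hxN).2.symm⟩) (mem_nbrs.2 ⟨hDW (by simp), hxx⟩)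
    (hne v hvR x' (by simp))
  obtain ⟨y₂, hy1, hy2, hy⟩ := exists_third hy3 (p := v) (q := y')
    (mem_nbrs.2 ⟨hv, (mem_nbrs.1 hyN).2.symm⟩) (mem_nbrs.2 ⟨hDW (by simp), hyy⟩)
    (hne v hvR y' (by simp))
  have hxa : x₂ ∈ nbrs G W x := by simp [hx]
  have hya : y₂ ∈ nbrs G W y := by simp [hy]
  rw [mem_nbrs] at hxa hya
  have hxS : x₂ ∉ S := hfresh hxN hxx h rfl hx1 hx2 hxa.2
  have hyS : y₂ ∉ S := hfresh hyN hyy h.rotate (by ext; simp; tauto) hy1 hy2 hya.2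
  have hxz' : ¬ G.Adj x z' := fun hadj =>
    hne x (hNR x hxN) y' (by simp) (h.swap.eq_of_adj hG hxx hadj)
  have hyz' : ¬ G.Adj y z' := fun hadj =>
    hne y (hNR y hyN) x' (by simp) (h.rotate.eq_of_adj hG hyy hadj)
  have hz' : nbrs G W z' ⊆ S := by
    intro t ht
    rw [mem_nbrs] at ht
    by_cases htR : t ∈ R
    · exact Finset.mem_union_left _ htR
    · exact Finset.mem_union_right _ (hD.2 z' (by simp) t (Finset.mem_sdiff.2 ⟨ht.1, htR⟩) ht.2)
  have hxS' : x ∈ S := Finset.mem_union_left _ (hNR x hxN)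
  have hyS' : y ∈ S := Finset.mem_union_left _ (hNR y hyN)
  have hzS' : z' ∈ S := Finset.mem_union_right _ (by simp)
  have hvS : v ∈ S := Finset.mem_union_left _ hvR
  have hxS'' : x' ∈ S := Finset.mem_union_right _ (by simp)
  have hyS'' : y' ∈ S := Finset.mem_union_right _ (by simp)
  have hI : IsIndepSet G {x, y, z'} := by
    refine isIndepSet_insert (isIndepSet_pair hyz') ?_
    simpa using ⟨hind x hxN y hyN, hxz'⟩
  have hIc : ({x, y, z'} : Finset V).card = 3 :=
    Finset.card_eq_three.2 ⟨x, y, z', hne3.1, hne x (hNR x hxN) z' (by simp),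
      hne y (hNR y hyN) z' (by simp), rfl⟩
  have hred : IsReduction G W (insert x₂ (insert y₂ S)) {x, y, z'} := by
    refine ⟨?_, ?_, hI, ?_⟩
    · simp [Finset.insert_subset_iff, hxa.1, hya.1, hSW]
    · simp [Finset.insert_subset_iff, hxS', hyS', hzS']
    · simp only [Finset.mem_insert, Finset.mem_singleton, forall_eq_or_imp, forall_eq, hx, hy]
      refine ⟨?_, ?_, fun t ht => ?_⟩
      · simp [Finset.insert_subset_iff, hvS, hxS'']
      · simp [Finset.insert_subset_iff, hvS, hyS'']
      · simp [hz' ht]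
  by_cases hxy : x₂ = y₂
  · subst hxy
    rw [Finset.insert_idem] at hred
    have h11 := edgesIn_insert_ge (G := G) hxS (S := {x, y}) (by simp [Finset.insert_subset_iff, *])
      (by simp [hxa.2.symm, hya.2.symm])
    rw [Finset.card_pair hne3.1] at h11
    have := hW.reduce_inner hred (by simp) (m := 11) (by omega)
    rw [Finset.card_insert_of_notMem hxS, hSc, hIc] at this
    push_cast at this
    linarith [hW.three_triangles, hW.add_three_mul_lt_one ⟨v, hv⟩, hW.b_pos]
  · have h10 := edgesIn_insert_ge hyS (S := {y}) (by simpa using hyS') (by simpa using hya.2.symm)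
    have hxS2 : x₂ ∉ insert y₂ S := by simp [hxy, hxS]
    have h11 := edgesIn_insert_ge hxS2 (S := {x}) (by simp [hxS']) (by simpa using hxa.2.symm)
    rw [Finset.card_singleton] at h10 h11
    have := hW.reduce_inner hred (by simp) (m := 11) (by omega)
    rw [Finset.card_insert_of_notMem hxS2, Finset.card_insert_of_notMem hyS, hSc, hIc] at this
    push_cast at this
    linarith [hW.three_triangles]

/-- A vertex of degree 3 lies in a triangle. -/
lemma exists_adj_nbrs (hW : IsMinimalCounterexample G a b W) {v : V} (hv : v ∈ W)
    (h3 : (nbrs G W v).card = 3) : ∃ x ∈ nbrs G W v, ∃ y ∈ nbrs G W v, G.Adj x y := by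
  by_contra! hind
  have hred := isReduction_closedNbhd (G := G) hv
  have he : edgesIn G (insert v (nbrs G W v)) = 3 := by
    rw [edgesIn_closedNbhd, edgesIn_eq_zero hind, h3]
  have hsum := sum_card_nbrs (G := G) hred.subset
  rw [Finset.sum_insert (notMem_nbrs_self v), he, h3] at hsum
  have hge : 3 * 3 ≤ ∑ t ∈ nbrs G W v, (nbrs G W t).card := by
    calc 3 * 3 = ∑ t ∈ nbrs G W v, 3 := by simp [h3]
      _ ≤ _ := Finset.sum_le_sum fun t ht => hW.three_le_card_nbrs (mem_nbrs.1 ht).1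
  have h3m := hW.three_mul_card_difficultSets_le hred.subset
  obtain ⟨D, hD, hD6⟩ : ∃ D ∈ difficultSets G (W \ insert v (nbrs G W v)), D.card ≠ 6 := by
    by_contra! h6
    have := hW.closedNbhd_edges_le hv h3 h6
    omega
  have hlt : ¬ 9 + (difficultSets G (W \ insert v (nbrs G W v))).card ≤
      edgesIn G (insert v (nbrs G W v)) +
        edgesBetween G (insert v (nbrs G W v)) (W \ insert v (nbrs G W v)) := fun hle => by
    have := hW.reduce hred (by simp) hle
    rw [Finset.card_insert_of_notMem (notMem_nbrs_self v), h3, Finset.card_singleton] at this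
    push_cast at this
    linarith [hW.delete_nbhd_three]
  obtain ⟨x, y, z, x', y', z', hN, h, rfl, hxx, hyy, hzz⟩ := hW.exists_matching hv h3 hD hD6
  have hcl := (mem_difficultSets.1 hD).2
  have hmem : ∀ t ∈ ({x, y, z} : Finset V), 3 ≤ (nbrs G W t).card := fun t ht =>
    hW.three_le_card_nbrs (mem_nbrs.1 (hN ▸ ht)).1
  simp only [Finset.mem_insert, Finset.mem_singleton, forall_eq_or_imp, forall_eq] at hmem
  have hne : x ∉ ({y, z} : Finset V) ∧ y ∉ ({z} : Finset V) := by
    rw [hN] at h3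
    constructor <;> intro hmem <;> rw [Finset.insert_eq_of_mem hmem] at h3 <;>
      exact absurd h3 (ne_of_lt (lt_of_le_of_lt Finset.card_le_two (by norm_num)))
  have hsum3 : ∑ t ∈ nbrs G W v, (nbrs G W t).card =
      (nbrs G W x).card + ((nbrs G W y).card + (nbrs G W z).card) := by
    rw [hN, Finset.sum_insert hne.1, Finset.sum_insert hne.2, Finset.sum_singleton]
  have hcases : (nbrs G W x).card = 3 ∧ (nbrs G W y).card = 3 ∨
      (nbrs G W y).card = 3 ∧ (nbrs G W z).card = 3 ∨
      (nbrs G W x).card = 3 ∧ (nbrs G W z).card = 3 := by omega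
  rcases hcases with ⟨h1, h2⟩ | ⟨h1, h2⟩ | ⟨h1, h2⟩
  · exact hW.false_of_matching hv h3 hind hN hcl h hxx hyy hzz h1 h2
  · have hs : ({x', y', z'} : Finset V) = {y', z', x'} := by ext; simp; tauto
    exact hW.false_of_matching hv h3 hind (hN.trans (by ext; simp; tauto)) (hs ▸ hcl) h.rotate
      hyy hzz hxx h1 h2
  · have hs : ({x', y', z'} : Finset V) = {x', z', y'} := by ext; simp; tauto
    exact hW.false_of_matching hv h3 hind (hN.trans (by ext; simp; tauto)) (hs ▸ hcl) h.swap
      hxx hzz hyy h1 h2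

lemma card_nbrs_eq_three_of_mem (hW : IsMinimalCounterexample G a b W) {v : V} (hv : v ∈ W)
    (h3 : (nbrs G W v).card = 3) : ∀ t ∈ nbrs G W v, (nbrs G W t).card = 3 := by
  have hred := isReduction_closedNbhd (G := G) hv
  obtain ⟨x, hx, y, hy, hxy⟩ := hW.exists_adj_nbrs hv h3
  have h8 := hW.closedNbhd_edges_le hv h3 fun D hD => by
    by_contra h6
    obtain ⟨p, q, r, p', q', r', hN, h, rfl, hp, hq, hr⟩ := hW.exists_matching hv h3 hD h6
    have key : ∀ t ∈ nbrs G W v, ∃ d ∈ ({p', q', r'} : Finset V), G.Adj t d := by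
      rw [hN]
      simp only [Finset.mem_insert, Finset.mem_singleton, forall_eq_or_imp, forall_eq]
      exact ⟨⟨p', by simp [hp]⟩, ⟨q', by simp [hq]⟩, ⟨r', by simp [hr]⟩⟩
    obtain ⟨d, hd, hxd⟩ := key x hx
    obtain ⟨d', hd', hyd⟩ := key y hy
    have htri : IsTri G x y v := ⟨hxy, (mem_nbrs.1 hy).2.symm, (mem_nbrs.1 hx).2.symm⟩
    have hdR := (Finset.mem_sdiff.1 ((mem_difficultSets.1 hD).2.1 hd)).2
    have hdR' := (Finset.mem_sdiff.1 ((mem_difficultSets.1 hD).2.1 hd')).2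
    have hdd : d ≠ d' := by
      rintro rfl
      exact hdR (by simp [htri.eq_of_adj hW.noTriC4 hxd.symm hyd.symm])
    refine htri.not_square hW.noTriC4 hxd hyd ?_ ?_ ?_
    · have := G.adj_comm
      have := h.1
      have := h.2.1
      have := h.2.2
      simp only [Finset.mem_insert, Finset.mem_singleton] at hd hd'
      grind
    · rintro rfl
      exact hdR (Finset.mem_insert_of_mem hy)
    · rintro rfl
      exact hdR' (Finset.mem_insert_of_mem hx)
  have hsum := sum_card_nbrs (G := G) hred.subset
  have h2 := two_mul_edgesIn_nbrs_le (W := W) hW.noTriC4 v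
  have he := edgesIn_closedNbhd (G := G) (W := W) v
  rw [Finset.sum_insert (notMem_nbrs_self v)] at hsum
  have hge : ∀ t ∈ nbrs G W v, 3 ≤ (nbrs G W t).card := fun t ht =>
    hW.three_le_card_nbrs (mem_nbrs.1 ht).1
  have hle : ∑ t ∈ nbrs G W v, (nbrs G W t).card ≤ ∑ t ∈ nbrs G W v, 3 := by
    rw [Finset.sum_const, h3, smul_eq_mul]
    omega
  intro t ht
  exact ((Finset.sum_eq_sum_iff_of_le hge).1 (hle.antisymm' (Finset.sum_le_sum hge)) t ht).symm

/-- The structure of the neighbourhood of a vertex of degree 3. -/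
lemma exists_nbrs_eq (hW : IsMinimalCounterexample G a b W) {v : V} (hv : v ∈ W)
    (h3 : (nbrs G W v).card = 3) : ∃ x y z, nbrs G W v = {x, y, z} ∧ IsTri G v x y ∧
      z ≠ x ∧ z ≠ y := by
  obtain ⟨x, hx, y, hy, hxy⟩ := hW.exists_adj_nbrs hv h3
  obtain ⟨z, hzx, hzy, h⟩ := exists_third h3 hx hy hxy.ne
  exact ⟨x, y, z, h, ⟨(mem_nbrs.1 hx).2, hxy, (mem_nbrs.1 hy).2⟩, hzx, hzy⟩

lemma exists_isTri_of_forall_not_isTri (hW : IsMinimalCounterexample G a b W) {v w : V}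
    (hv : v ∈ W) (h3 : (nbrs G W v).card = 3) (hw : w ∈ W) (hvw : G.Adj v w)
    (h : ∀ u ∈ W, ¬ IsTri G v w u) :
    ∃ x y, nbrs G W v = {x, y, w} ∧ IsTri G v x y := by
  obtain ⟨x, y, z, hN, hT, hzx, hzy⟩ := hW.exists_nbrs_eq hv h3
  have hx : x ∈ nbrs G W v := by simp [hN]
  have hy : y ∈ nbrs G W v := by simp [hN]
  have hw' : w ∈ nbrs G W v := mem_nbrs.2 ⟨hw, hvw⟩
  rw [hN] at hw'
  simp only [Finset.mem_insert, Finset.mem_singleton] at hw'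
  rcases hw' with rfl | rfl | rfl
  · exact absurd hT (h y (mem_nbrs.1 hy).1)
  · exact absurd hT.swap (h x (mem_nbrs.1 hx).1)
  · exact ⟨x, y, hN, hT⟩

/-- If the edges from `R` to the `y`-vertices of end triangles start at `v` or at one of two
adjacent vertices, every end triangle has a neighbour of `v`. -/
lemma adj_of_isEndTri (hW : IsMinimalCounterexample G a b W) {R : Finset V} (hR : R ⊆ W)
    {v p q x y z : V} (hpq : G.Adj p q) (h : IsEndTri G (W \ R) x y z)
    (hout : ∀ x y z, IsEndTri G (W \ R) x y z → ∀ r ∈ R, G.Adj y r → r = v ∨ r = p ∨ r = q) :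
    G.Adj v y ∨ G.Adj v z := by
  have hG := hW.noTriC4
  have h' : IsEndTri G (W \ R) x z y :=
    ⟨h.tri.swap, fun t ht => h.subset (by simp at ht ⊢; tauto), h.nbrs_x, h.nbrs_z, h.nbrs_y⟩
  obtain ⟨e, he⟩ := Finset.card_pos.1 (hW.one_le_card_nbrs hR h.tri.rotate.swap
    (fun t ht => h.subset (by simp at ht ⊢; tauto)) h.nbrs_y)
  obtain ⟨f, hf⟩ := Finset.card_pos.1 (hW.one_le_card_nbrs hR h.tri.rotate.rotate
    (fun t ht => h.subset (by simp at ht ⊢; tauto)) h.nbrs_z)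
  rw [mem_nbrs] at he hf
  have hnR : ∀ t ∈ ({x, y, z} : Finset V), t ∉ R := fun t ht =>
    (Finset.mem_sdiff.1 (h.subset ht)).2
  have hef : e ≠ f := by
    rintro rfl
    exact hnR x (by simp) (h.tri.rotate.eq_of_adj hG he.2.symm hf.2.symm ▸ he.1)
  have hnef : ¬ G.Adj e f := fun hadj => h.tri.rotate.not_square hG he.2 hf.2 hadj
    (fun h => hnR z (by simp) (h ▸ he.1)) (fun h => hnR y (by simp) (h ▸ hf.1))
  rcases hout _ _ _ h e he.1 he.2 with rfl | rfl | rfl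
  · exact .inl he.2.symm
  · rcases hout _ _ _ h' f hf.1 hf.2 with rfl | rfl | rfl
    · exact .inr hf.2.symm
    · exact absurd rfl hef
    · exact absurd hpq hnef
  · rcases hout _ _ _ h' f hf.1 hf.2 with rfl | rfl | rfl
    · exact .inr hf.2.symm
    · exact absurd hpq.symm hnef
    · exact absurd rfl hef

lemma card_nbrs_ne_three (hW : IsMinimalCounterexample G a b W) {v : V} (hv : v ∈ W) :
    (nbrs G W v).card ≠ 3 := by
  intro hv3
  have hG := hW.noTriC4
  have hdeg := fun {s t : V} (hs : s ∈ W) (ht : t ∈ W) (hst : G.Adj s t)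
      (h : (nbrs G W s).card = 3) => hW.card_nbrs_eq_three_of_mem hs h t (mem_nbrs.2 ⟨ht, hst⟩)
  obtain ⟨x, y, z, hNv, hT, hzx, hzy⟩ := hW.exists_nbrs_eq hv hv3
  have hmv : ∀ t, t ∈ W ∧ G.Adj v t ↔ t = x ∨ t = y ∨ t = z := fun t => by
    rw [← mem_nbrs, hNv]
    simp
  obtain ⟨hx, -⟩ := (hmv x).2 (by simp)
  obtain ⟨hy, -⟩ := (hmv y).2 (by simp)
  obtain ⟨hz, hvz⟩ := (hmv z).2 (by simp)
  have hx3 := hdeg hv hx hT.1 hv3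
  have hy3 := hdeg hv hy hT.2.2 hv3
  have hz3 := hdeg hv hz hvz hv3
  have hzx' : ¬ G.Adj z x := fun h => hzy (hT.eq_of_adj hG hvz.symm h)
  obtain ⟨x', hx'v, hx'y, hNx⟩ := exists_third hx3 (mem_nbrs.2 ⟨hv, hT.1.symm⟩)
    (mem_nbrs.2 ⟨hy, hT.2.1⟩) hT.2.2.ne
  have hmx : ∀ t, t ∈ W ∧ G.Adj x t ↔ t = v ∨ t = y ∨ t = x' := fun t => by
    rw [← mem_nbrs, hNx]
    simp
  obtain ⟨hx', hxx⟩ := (hmx x').2 (by simp)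
  have hx'3 := hdeg hx hx' hxx hx3
  have hvx' : ¬ G.Adj v x' := fun h => hx'y (hT.eq_of_adj hG h.symm hxx.symm)
  have hyx' : ¬ G.Adj y x' := fun h => hx'v (hT.rotate.eq_of_adj hG hxx.symm h.symm)
  have hzx'' : ¬ G.Adj z x' := fun h => hT.not_square hG hvz hxx h hzx hx'v
  obtain ⟨y', hy'v, hy'x, hNy⟩ := exists_third hy3 (mem_nbrs.2 ⟨hv, hT.2.2.symm⟩)
    (mem_nbrs.2 ⟨hx, hT.2.1.symm⟩) hT.1.ne
  have hmy : ∀ t, t ∈ W ∧ G.Adj y t ↔ t = v ∨ t = x ∨ t = y' := fun t => by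
    rw [← mem_nbrs, hNy]
    simp
  have htri : ∀ t, t ∈ W → G.Adj x' t → G.Adj x t → False := fun t ht h1 h2 => by
    rcases (hmx t).1 ⟨ht, h2⟩ with rfl | rfl | rfl
    · exact hvx' h1.symm
    · exact hyx' h1.symm
    · exact G.loopless.irrefl _ h1
  obtain ⟨p, q, hNx', hT'⟩ := hW.exists_isTri_of_forall_not_isTri hx' hx'3 hx hxx.symm
    fun u hu h => htri u hu h.2.2 h.2.1
  have hmx' : ∀ t, t ∈ W ∧ G.Adj x' t ↔ t = p ∨ t = q ∨ t = x := fun t => by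
    rw [← mem_nbrs, hNx']
    simp
  obtain ⟨hp, -⟩ := (hmx' p).2 (by simp)
  obtain ⟨hq, -⟩ := (hmx' q).2 (by simp)
  have hxp : p ≠ x := by
    rintro rfl
    exact htri q hq hT'.2.2 hT'.2.1
  have hxq : q ≠ x := by
    rintro rfl
    exact htri p hp hT'.1 hT'.2.1.symm
  have hp3 := hdeg hx' hp hT'.1 hx'3
  have hq3 := hdeg hx' hq hT'.2.2 hx'3
  obtain ⟨r, s, hNz, hTz⟩ := hW.exists_isTri_of_forall_not_isTri hz hz3 hv hvz.symm
    fun u hu h => by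
      rcases (hmv u).1 ⟨hu, h.2.1⟩ with rfl | rfl | rfl
      · exact hzx' h.2.2
      · exact hzx (hT.swap.eq_of_adj hG hvz.symm h.2.2)
      · exact G.loopless.irrefl _ h.2.2
  have hmz : ∀ t, t ∈ W ∧ G.Adj z t ↔ t = r ∨ t = s ∨ t = v := fun t => by
    rw [← mem_nbrs, hNz]
    simp
  obtain ⟨hr, -⟩ := (hmz r).2 (by simp)
  obtain ⟨hs, -⟩ := (hmz s).2 (by simp)
  have hzt : ∀ t ∈ W, t ≠ v → G.Adj z t → ∃ u ∈ W, IsTri G z t u := fun t ht htv h => by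
    rcases (hmz t).1 ⟨ht, h⟩ with rfl | rfl | rfl
    · exact ⟨s, hs, hTz⟩
    · exact ⟨r, hr, hTz.swap⟩
    · exact absurd rfl htv
  have hpv : p ≠ v := by
    rintro rfl
    exact hvx' hT'.1.symm
  have hqv : q ≠ v := by
    rintro rfl
    exact hvx' hT'.2.2.symm
  have hx'z : x' ≠ z := by
    rintro rfl
    exact hzx' hxx.symm
  have hpz : p ≠ z := by
    rintro rfl
    exact hzx'' hT'.1.symm
  have hqz : q ≠ z := by
    rintro rfl
    exact hzx'' hT'.2.2.symm
  have hzp : ¬ G.Adj z p := fun h => by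
    obtain ⟨u, hu, htu⟩ := hzt p hp hpv h
    exact hT'.rotate.not_isTri_of_card_eq_three hG hq hx' hp3 hz hu hqz.symm hx'z.symm htu
  have hzq : ¬ G.Adj z q := fun h => by
    obtain ⟨u, hu, htu⟩ := hzt q hq hqv h
    exact hT'.rotate.rotate.not_isTri_of_card_eq_three hG hx' hp hq3 hz hu hx'z.symm hpz.symm htu
  have hyp : ¬ G.Adj y p := fun h => hT.rotate.not_square hG hxx h hT'.1 hx'y hxp
  have hyq : ¬ G.Adj y q := fun h => hT.rotate.not_square hG hxx h hT'.2.2 hx'y hxq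
  have hyp' : p ≠ y := by
    rintro rfl
    exact hyx' hT'.1.symm
  have hyq' : q ≠ y := by
    rintro rfl
    exact hyx' hT'.2.2.symm
  have hvp : ¬ G.Adj v p := fun h => by
    have := (hmv p).1 ⟨hp, h⟩
    grind
  have hvq : ¬ G.Adj v q := fun h => by
    have := (hmv q).1 ⟨hq, h⟩
    grind
  have hxp' : ¬ G.Adj x p := fun h => htri p hp hT'.1 h
  have hxq' : ¬ G.Adj x q := fun h => htri q hq hT'.2.2 h
  have hdisj : Disjoint (insert v (nbrs G W v)) {x', p, q} := by
    have := hxx.ne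
    rw [Finset.disjoint_left, hNv]
    simp only [Finset.mem_insert, Finset.mem_singleton]
    grind
  set A := insert v (nbrs G W v) with hA
  set R := A ∪ {x', p, q} with hR
  have hmR : ∀ t, t ∈ R ↔ t = v ∨ t = x ∨ t = y ∨ t = z ∨ t = x' ∨ t = p ∨ t = q := fun t => by
    simp only [hR, hA, hNv, Finset.mem_union, Finset.mem_insert, Finset.mem_singleton,
      or_assoc]
  have hRW : R ⊆ W := fun t ht => by
    rcases (hmR t).1 ht with rfl | rfl | rfl | rfl | rfl | rfl | rfl <;> assumption
  have hred : IsReduction G W R {v, x'} := by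
    refine ⟨hRW, ?_, isIndepSet_pair hvx', ?_⟩
    · simp [Finset.insert_subset_iff, hmR]
    · simp only [Finset.mem_insert, Finset.mem_singleton, forall_eq_or_imp, forall_eq, hNv, hNx']
      simp [Finset.insert_subset_iff, hmR]
  have hAc : A.card = 4 := by
    rw [hA, Finset.card_insert_of_notMem (notMem_nbrs_self v), hv3]
  have hRc : R.card = 7 := by
    rw [hR, Finset.card_union_of_disjoint hdisj, hAc, hT'.card_eq]
  have heA : edgesIn G A ≤ 4 := by
    have : edgesIn G A = _ := edgesIn_closedNbhd v
    have := two_mul_edgesIn_nbrs_le (W := W) hG v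
    omega
  have hBA : edgesBetween G {x', p, q} A ≤ 1 := by
    have h0 : ∀ t ∈ ({p, q} : Finset V), nbrs G A t = ∅ := fun t ht => by
      refine Finset.filter_eq_empty_iff.2 fun u hu hadj => ?_
      rw [hA, hNv] at hu
      have hadj := hadj.symm
      simp only [Finset.mem_insert, Finset.mem_singleton] at ht hu
      rcases ht with rfl | rfl <;> rcases hu with rfl | rfl | rfl | rfl <;> contradiction
    have h1 : nbrs G A x' ⊆ {x} := fun t ht => by
      rw [mem_nbrs] at ht
      have htA := fun h => Finset.disjoint_left.1 hdisj ht.1 h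
      have := (hmx' t).1 ⟨hRW (Finset.mem_union_left _ ht.1), ht.2⟩
      simp only [Finset.mem_insert, Finset.mem_singleton] at htA ⊢
      grind
    rw [edgesBetween, Finset.sum_insert (by simp [hT'.1.ne, hT'.2.2.ne]),
      Finset.sum_pair hT'.2.1.ne, h0 p (by simp), h0 q (by simp)]
    simpa using Finset.card_le_card h1
  have heR : edgesIn G R ≤ 8 := by
    rw [hR, edgesIn_union hdisj, hT'.edgesIn_eq, edgesBetween_comm]
    omega
  have hR3 : ∀ t ∈ R, (nbrs G W t).card = 3 := fun t ht => by
    rcases (hmR t).1 ht with rfl | rfl | rfl | rfl | rfl | rfl | rfl <;> assumption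
  have hsum := sum_card_nbrs (G := G) hRW
  rw [Finset.sum_congr rfl hR3, Finset.sum_const, hRc, smul_eq_mul] at hsum
  have hout : ∀ x₁ y₁ z₁, IsEndTri G (W \ R) x₁ y₁ z₁ → ∀ e ∈ R, G.Adj y₁ e →
      e = y ∨ e = p ∨ e = q := by
    intro x₁ y₁ z₁ h e heR he
    obtain ⟨hx₁, hy₁, hz₁⟩ : x₁ ∈ W \ R ∧ y₁ ∈ W \ R ∧ z₁ ∈ W \ R := by
      simpa only [Finset.insert_subset_iff, Finset.singleton_subset_iff] using h.subset
    rw [Finset.mem_sdiff] at hx₁ hy₁ hz₁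
    have hadj : y₁ ∈ W ∧ G.Adj e y₁ := ⟨hy₁.1, he.symm⟩
    have hy₁R := (hmR y₁).not.1 hy₁.2
    simp only [not_or] at hy₁R
    rcases (hmR e).1 heR with rfl | rfl | rfl | rfl | rfl | he | he
    · simpa [hy₁R] using (hmv y₁).1 hadj
    · simpa [hy₁R] using (hmx y₁).1 hadj
    · exact .inl rfl
    · obtain ⟨u, hu, htu⟩ := hzt y₁ hy₁.1 hy₁R.1 he.symm
      exact absurd htu (h.tri.rotate.not_isTri_of_card_eq_three hG hz₁.1 hx₁.1
        (hdeg hz hy₁.1 he.symm hz3) hz hu (fun h => hz₁.2 (h ▸ heR)) (fun h => hx₁.2 (h ▸ heR)))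
    · simpa [hy₁R] using (hmx' y₁).1 hadj
    · exact .inr (.inl he)
    · exact .inr (.inr he)
  have hy1 : ∀ s ∈ W \ R, ∀ t ∈ W \ R, G.Adj y s → G.Adj y t → s = t := fun s hs t ht h1 h2 => by
    rw [Finset.mem_sdiff, hmR] at hs ht
    have := (hmy s).1 ⟨hs.1, h1⟩
    have := (hmy t).1 ⟨ht.1, h2⟩
    grind
  have hempty := difficultSets_eq_empty_of_adj hG hy1 fun _ _ _ h =>
    hW.adj_of_isEndTri hRW hT'.2.1 h hout
  have := hW.reduce hred ⟨v, by simp [hmR]⟩ (m := 13) (by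
    rw [hempty, Finset.card_empty]
    omega)
  have hvx : v ≠ x' := hx'v.symm
  rw [hRc, Finset.card_pair hvx] at this
  push_cast at this
  linarith [hW.three_triangles, hW.delete_five]

end IsMinimalCounterexample

open IsMinimalCounterexample in
lemma not_isMinimalCounterexample (W : Finset V) : ¬ IsMinimalCounterexample G a b W := by
  intro hW
  have h4 : ∀ t ∈ W, (nbrs G W t).card = 4 := fun t ht => by
    have := hW.three_le_card_nbrs ht
    have := hW.card_nbrs_le_four ht
    have := hW.card_nbrs_ne_three ht
    omega
  obtain ⟨v, hv⟩ := hW.nonempty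
  have hred := isReduction_closedNbhd (G := G) hv
  have hRW := hred.subset
  have he := edgesIn_closedNbhd (G := G) (W := W) v
  have h2 := two_mul_edgesIn_nbrs_le (W := W) hW.noTriC4 v
  have hRc : (insert v (nbrs G W v)).card = 5 := by
    rw [Finset.card_insert_of_notMem (notMem_nbrs_self v), h4 v hv]
  have hsum := sum_card_nbrs (G := G) hRW
  rw [Finset.sum_congr rfl fun t ht => h4 t (hRW ht), Finset.sum_const, hRc, smul_eq_mul] at hsum
  have hend : ∀ {x y z : V}, ¬ IsEndTri G (W \ insert v (nbrs G W v)) x y z := fun {x y z} h => by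
    have hle := sum_card_nbrs_closedNbhd_le hW.noTriC4 h.tri h.subset
    have hdeg : ∀ t ∈ ({x, y, z} : Finset V), _ := fun t ht =>
      (card_nbrs_sdiff hRW t).symm.trans (h4 t (Finset.mem_sdiff.1 (h.subset ht)).1)
    rw [Finset.sum_insert (by simp [h.tri.1.ne, h.tri.2.2.ne]), Finset.sum_pair h.tri.2.1.ne,
      h4 v hv] at hle
    have hx := hdeg x (by simp)
    have hy := hdeg y (by simp)
    have hz := hdeg z (by simp)
    have := h.nbrs_x
    have := (Finset.card_le_card h.nbrs_y).trans Finset.card_le_two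
    have := (Finset.card_le_card h.nbrs_z).trans Finset.card_le_two
    omega
  have hempty : difficultSets G (W \ insert v (nbrs G W v)) = ∅ := by
    refine Finset.eq_empty_of_forall_notMem fun D hD => ?_
    rcases exists_isEndTri hW.noTriC4 hD with ⟨x, y, z, h, -⟩ | ⟨x, y, z, u, v, w, h, -⟩
    · exact hend h
    · exact hend h
  have h4v := h4 v hv
  have := hW.reduce hred (by simp) (m := 14) (by
    rw [hempty, Finset.card_empty]
    omega)
  rw [hRc, Finset.card_singleton] at this
  push_cast at this
  linarith [hW.delete_nbhd_four]

end MinimalCounterexample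

section Components

variable {V : Type} {G : SimpleGraph V}

lemma nonempty_induce_range_iso {α : Type} {H : SimpleGraph α} {f : α → V}
    (hf : Function.Injective f) (h : ∀ i j, G.Adj (f i) (f j) ↔ H.Adj i j) :
    Nonempty (SimpleGraph.induce (Set.range f) G ≃g H) :=
  ⟨(RelIso.mk (Equiv.ofInjective f hf) (by simp [h]) : H ≃g _).symm⟩

variable [Fintype V]

open scoped Classical

lemma supp_eq_of_mem_difficultSets {D : Finset V} (hD : D ∈ difficultSets G Finset.univ) {x : V}
    (hx : x ∈ D) : (G.connectedComponentMk x).supp = D := by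
  rw [mem_difficultSets] at hD
  have hwalk : ∀ u v, G.Walk u v → u ∈ D → v ∈ D := fun u v p => by
    induction p with
    | nil => exact id
    | cons h _ ih => exact fun hu => ih (hD.2.2 _ hu _ (Finset.mem_univ _) h)
  ext t
  rw [SimpleGraph.ConnectedComponent.mem_supp_iff, SimpleGraph.ConnectedComponent.eq,
    Finset.mem_coe]
  refine ⟨fun ⟨p⟩ => hwalk x t p.reverse hx, fun ht => ?_⟩
  have hcl : IsClosedIn G Finset.univ (Finset.univ.filter fun t => G.Reachable t x) :=
    ⟨Finset.subset_univ _, fun u hu w _ huw => by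
      simp only [Finset.mem_filter, Finset.mem_univ, true_and] at hu ⊢
      exact huw.symm.reachable.trans hu⟩
  simpa using hD.1.subset_of_isClosedIn hD.2.1 hcl hx (by simp) ht

lemma isDifficult_of_mem_difficultSets (hG : ¬ HasTriangleAdjC4 G) {D : Finset V}
    (hD : D ∈ difficultSets G Finset.univ) {x : V} (hx : x ∈ D) :
    IsDifficult G (G.connectedComponentMk x) := by
  rw [IsDifficult, supp_eq_of_mem_difficultSets hD hx]
  rcases exists_isEndTri hG hD with ⟨x, y, z, h, -, rfl⟩ | ⟨x, y, z, u, v, w, h, h', hxu, hd, rfl⟩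
  · left
    have hrange : (({x, y, z} : Finset V) : Set V) = Set.range ![x, y, z] := by
      ext t
      simp
      tauto
    have h1 := h.tri.1
    have h2 := h.tri.2.1
    have h3 := h.tri.2.2
    rw [hrange]
    refine nonempty_induce_range_iso (fun i j => ?_) (fun i j => ?_)
    · fin_cases i <;> fin_cases j <;>
        simp [h1.ne, h2.ne, h3.ne, h1.ne', h2.ne', h3.ne']
    · fin_cases i <;> fin_cases j <;> simp [h1, h2, h3, h1.symm, h2.symm, h3.symm]
  · right
    have hrange : (({x, y, z} ∪ {u, v, w} : Finset V) : Set V) = Set.range ![y, z, x, u, v, w] := by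
      ext t
      simp
      tauto
    have h1 := h.tri.1
    have h2 := h.tri.2.1
    have h3 := h.tri.2.2
    have h1' := h'.tri.1
    have h2' := h'.tri.2.1
    have h3' := h'.tri.2.2
    have hne : ∀ s ∈ ({x, y, z} : Finset V), ∀ t ∈ ({u, v, w} : Finset V), s ≠ t ∧ t ≠ s :=
      fun s hs t ht => ⟨Finset.disjoint_iff_ne.1 hd s hs t ht,
        (Finset.disjoint_iff_ne.1 hd s hs t ht).symm⟩
    simp only [Finset.mem_insert, Finset.mem_singleton, forall_eq_or_imp, forall_eq] at hne
    have key : ∀ {s : V} {T : Finset V}, nbrs G Finset.univ s ⊆ T → ∀ t ∉ T,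
        ¬ G.Adj s t ∧ ¬ G.Adj t s := fun {s T} hs t ht =>
      ⟨fun h => ht (hs (mem_nbrs.2 ⟨Finset.mem_univ _, h⟩)),
        fun h => ht (hs (mem_nbrs.2 ⟨Finset.mem_univ _, h.symm⟩))⟩
    have hy := fun t => key h.nbrs_y t
    have hz := fun t => key h.nbrs_z t
    have hv := fun t => key h'.nbrs_y t
    have hw := fun t => key h'.nbrs_z t
    have hyu := hy u (by simp [hne])
    have hyv := hy v (by simp [hne])
    have hyw := hy w (by simp [hne])
    have hzu := hz u (by simp [hne])
    have hzv := hz v (by simp [hne])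
    have hzw := hz w (by simp [hne])
    have hvx := hv x (by simp [hne])
    have hwx := hw x (by simp [hne])
    rw [hrange]
    refine nonempty_induce_range_iso (fun i j => ?_) (fun i j => ?_)
    · fin_cases i <;> fin_cases j <;>
        simp [h1.ne, h2.ne, h3.ne, h1.ne', h2.ne', h3.ne', h1'.ne, h2'.ne, h3'.ne, h1'.ne',
          h2'.ne', h3'.ne', hne]
    · fin_cases i <;> fin_cases j <;>
        simp [chainGraph, h1, h2, h3, h1.symm, h2.symm, h3.symm, h1', h2', h3', h1'.symm,
          h2'.symm, h3'.symm, hxu, hxu.symm, hyu, hyv, hyw, hzu, hzv, hzw, hvx, hwx]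

lemma card_difficultSets_univ_le (hG : ¬ HasTriangleAdjC4 G) :
    (difficultSets G Finset.univ).card ≤ lambda G := by
  have hne : ∀ D : difficultSets G Finset.univ, D.1.Nonempty := fun D =>
    (mem_difficultSets.1 D.2).1.nonempty
  rw [lambda, ← Fintype.card_coe, ← Nat.card_eq_fintype_card]
  refine Nat.card_le_card_of_injective (fun D => ⟨G.connectedComponentMk (hne D).choose,
    isDifficult_of_mem_difficultSets hG D.2 (hne D).choose_spec⟩) fun D D' h => ?_
  have h := congrArg SimpleGraph.ConnectedComponent.supp (Subtype.mk.inj h)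
  rw [supp_eq_of_mem_difficultSets D.2 (hne D).choose_spec,
    supp_eq_of_mem_difficultSets D'.2 (hne D').choose_spec] at h
  exact Subtype.ext (Finset.coe_injective h)

lemma numEdges_eq : numEdges G = edgesIn G Finset.univ :=
  Nat.subtype_card _ (by simp)

lemma IsIndepSet.card_le_indepNum {s : Finset V} (hs : IsIndepSet G s) :
    s.card ≤ indepNum G :=
  le_csSup ⟨Fintype.card V, fun _ ⟨t, _, ht⟩ => ht ▸ t.card_le_univ⟩ ⟨s, hs, rfl⟩

end Components

/-- Theorem 1.4 (technical theorem). -/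
theorem technical_theorem
(a b : ℝ) (ha : 0 < a) (hb : 0 < b)
    (h1 : 2 * a + b ≥ 1) (h2 : 3 * a + 4 * b ≥ 2) (h3 : 9 * a + 11 * b ≥ 6)
    (h4 : a + 5 * b ≥ 1) (h5 : 4 * a + 9 * b ≥ 3) (h6 : 10 * a + 16 * b ≥ 7)
    (h7 : 13 * a + 20 * b ≥ 8) (h8 : 5 * a + 14 * b ≥ 4)
    (h9 : a + (3 / 2) * b ≥ 2 / 3)
    {V : Type} [Fintype V] (G : SimpleGraph V)
    (hG : ¬ HasTriangleAdjC4 G) :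
    (indepNum G : ℝ) ≥
      (Nat.card V : ℝ) - (a * Nat.card V + b * numEdges G + b * lambda G) := by
  have hlarge : ∀ W : Finset V, HasLargeIndepSet G a b W := fun W => by
    induction W using Finset.strongInduction with
    | H W ih =>
      by_contra hW
      exact not_isMinimalCounterexample W ⟨ha, hb, h1, h3, h4, h5, h6, h8, hG, hW, ih⟩
  obtain ⟨s, -, hs, hcard⟩ := hlarge Finset.univ
  have hα : (s.card : ℝ) ≤ indepNum G := mod_cast hs.card_le_indepNum
  have hl : ((difficultSets G Finset.univ).card : ℝ) ≤ lambda G :=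
    mod_cast card_difficultSets_univ_le hG
  have hmul := mul_le_mul_of_nonneg_left hl hb.le
  rw [Finset.card_univ, ← Nat.card_eq_fintype_card, ← numEdges_eq] at hcard
  linarith

end Paper
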